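/- arXiv:1803.08011 — 6 statements merged into one kernel-verified Lean document; each statement's English description precedes it below -/
import Mathlib

section
/- Let α ∈ ℝ be badly approximable. Then there is a constant C = C(α) > 0 such that for every integer N ≥ 2, the empirical measure μ_N = (1/N) Σ_{n=1}^{N} δ_{{nα}} of the Kronecker sequence satisfies W₂(μ_N, dx) ≤ C √(log N) / N. -/
open MeasureTheory
open scoped ENNReal

/-- The `p`-Wasserstein distance between measures on the torus `𝕋 = ℝ/ℤ`,
defined as the infimum of `(∫ |x-y|^p dγ)^(1/p)` over all couplings `γ`. -/
noncomputable def Wdist (p : ℝ) (μ ν : Measure UnitAddCircle) : ℝ :=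
  sInf { c : ℝ | ∃ γ : Measure (UnitAddCircle × UnitAddCircle),
      γ.map Prod.fst = μ ∧ γ.map Prod.snd = ν ∧
      c = (∫ z, dist z.1 z.2 ^ p ∂γ) ^ (1 / p) }

/-- A real number `α` is badly approximable if `|α - p/q| ≥ c/q²` for some `c > 0`
and all rationals `p/q`. -/
def BadlyApproximable (α : ℝ) : Prop :=
  ∃ c : ℝ, 0 < c ∧ ∀ p : ℤ, ∀ q : ℕ, 1 ≤ q → c / (q : ℝ) ^ 2 ≤ |α - (p : ℝ) / (q : ℝ)|

/-- The empirical measure `(1/N) ∑_{n=1}^N δ_{{nα}}` of the Kronecker sequence on `𝕋`. -/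
noncomputable def kroneckerMeasure (α : ℝ) (N : ℕ) : Measure UnitAddCircle :=
  (N : ℝ≥0∞)⁻¹ • ∑ n ∈ Finset.Icc 1 N, Measure.dirac (((n : ℝ) * α : ℝ) : UnitAddCircle)


lemma sum_restrict_Ioc_div (N : ℕ) (s : ℝ) (m : ℕ) :
    ∑ i ∈ Finset.range m, (volume : Measure ℝ).restrict (Set.Ioc (s + i / N) (s + (i + 1) / N)) =
      volume.restrict (Set.Ioc s (s + m / N)) := by
  induction m with
  | zero => simp
  | succ m ih =>
    rw [Finset.sum_range_succ, ih, ← Measure.restrict_union _ measurableSet_Ioc,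
      Set.Ioc_union_Ioc_eq_Ioc]
    · push_cast; rfl
    · have : (0 : ℝ) ≤ m / N := by positivity
      linarith
    · gcongr; linarith
    · exact Set.Ioc_disjoint_Ioc_of_le le_rfl

lemma Wdist_two_sq_le {N : ℕ} (hN : 0 < N) (x : Fin N → ℝ) (s : ℝ) :
    Wdist 2 ((N : ℝ≥0∞)⁻¹ • ∑ i, Measure.dirac (x i : UnitAddCircle)) volume ≤
      √(∑ i : Fin N, ∫ t in (s + i / N)..(s + (i + 1) / N), (x i - t) ^ 2) := by
  have hN' : (0 : ℝ) < N := by exact_mod_cast hN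
  have hle (i : Fin N) : s + (i : ℝ) / N ≤ s + (i + 1) / N := by gcongr; linarith
  let ρ (i : Fin N) : Measure ℝ := volume.restrict (Set.Ioc (s + i / N) (s + (i + 1) / N))
  let g (i : Fin N) (t : ℝ) : UnitAddCircle × UnitAddCircle := (x i, t)
  have hmk : Measurable (fun t : ℝ => (t : UnitAddCircle)) := AddCircle.measurable_mk'
  have hg (i : Fin N) : Measurable (g i) := measurable_const.prodMk hmk
  have hρ : ∑ i, ρ i = volume.restrict (Set.Ioc s (s + 1)) := by
    have := sum_restrict_Ioc_div N s N
    rw [← Fin.sum_univ_eq_sum_range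
      (fun i => (volume : Measure ℝ).restrict (Set.Ioc (s + i / N) (s + (i + 1) / N))),
      div_self hN'.ne'] at this
    exact this
  have hmass (i : Fin N) : ρ i Set.univ = (N : ℝ≥0∞)⁻¹ := by
    have : s + ((i : ℝ) + 1) / N - (s + i / N) = (N : ℝ)⁻¹ := by field_simp; ring
    simp only [ρ, Measure.restrict_apply_univ, Real.volume_Ioc, this]
    rw [ENNReal.ofReal_inv_of_pos hN', ENNReal.ofReal_natCast]
  have hsq (i : Fin N) : Integrable (fun t : ℝ => (x i - t) ^ 2) (ρ i) :=
    ((by fun_prop : Continuous fun t : ℝ => (x i - t) ^ 2).intervalIntegrable _ _).1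
  have hdist : Measurable fun z : UnitAddCircle × UnitAddCircle => dist z.1 z.2 ^ (2 : ℝ) := by
    fun_prop
  have hbound (i : Fin N) (t : ℝ) :
      dist (x i : UnitAddCircle) (t : UnitAddCircle) ^ (2 : ℝ) ≤ (x i - t) ^ 2 := by
    rw [Real.rpow_two, dist_eq_norm, ← AddCircle.coe_sub, ← sq_abs (x i - t)]
    exact pow_le_pow_left₀ (norm_nonneg _) (QuotientAddGroup.norm_mk_le_norm) 2
  have hint (i : Fin N) :
      Integrable (fun z : UnitAddCircle × UnitAddCircle => dist z.1 z.2 ^ (2 : ℝ))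
        ((ρ i).map (g i)) := by
    rw [integrable_map_measure hdist.aestronglyMeasurable (hg i).aemeasurable]
    refine (hsq i).mono' (hdist.comp (hg i)).aestronglyMeasurable (.of_forall fun t => ?_)
    rw [Real.norm_of_nonneg (by simp only [Function.comp]; positivity)]
    exact hbound i t
  let γ : Measure (UnitAddCircle × UnitAddCircle) := ∑ i, (ρ i).map (g i)
  have hfst : γ.map Prod.fst = (N : ℝ≥0∞)⁻¹ • ∑ i, Measure.dirac (x i : UnitAddCircle) := by
    rw [Measure.map_finset_sum measurable_fst.aemeasurable, Finset.smul_sum]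
    refine Finset.sum_congr rfl fun i _ => ?_
    rw [Measure.map_map measurable_fst (hg i)]
    change (ρ i).map (fun _ => (x i : UnitAddCircle)) = _
    rw [Measure.map_const, hmass]
  have hsnd : γ.map Prod.snd = volume := by
    rw [Measure.map_finset_sum measurable_snd.aemeasurable,
      ← (UnitAddCircle.measurePreserving_mk s).map_eq, ← hρ,
      Measure.map_finset_sum (hmk.aemeasurable)]
    refine Finset.sum_congr rfl fun i _ => ?_
    rw [Measure.map_map measurable_snd (hg i)]
    rfl
  have hcost : ∫ z, dist z.1 z.2 ^ (2 : ℝ) ∂γ ≤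
      ∑ i : Fin N, ∫ t in (s + i / N)..(s + (i + 1) / N), (x i - t) ^ 2 := by
    rw [integral_finsetSum_measure fun i _ => hint i]
    refine Finset.sum_le_sum fun i _ => ?_
    rw [integral_map (hg i).aemeasurable hdist.aestronglyMeasurable,
      intervalIntegral.integral_of_le (hle i)]
    refine integral_mono_of_nonneg (.of_forall fun t => ?_) (hsq i) (.of_forall fun t => hbound i t)
    change 0 ≤ dist _ _ ^ (2 : ℝ)
    positivity
  have hbdd : BddBelow { c : ℝ | ∃ γ : Measure (UnitAddCircle × UnitAddCircle),
      γ.map Prod.fst = (N : ℝ≥0∞)⁻¹ • ∑ i, Measure.dirac (x i : UnitAddCircle) ∧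
      γ.map Prod.snd = volume ∧ c = (∫ z, dist z.1 z.2 ^ (2 : ℝ) ∂γ) ^ (1 / (2 : ℝ)) } := by
    refine ⟨0, ?_⟩
    rintro c ⟨γ', -, -, rfl⟩
    positivity
  refine (csInf_le hbdd ⟨γ, hfst, hsnd, rfl⟩).trans ?_
  rw [← Real.sqrt_eq_rpow]
  exact Real.sqrt_le_sqrt hcost

lemma integral_sub_sq_div (N : ℕ) (hN : 0 < N) (x s : ℝ) (i : ℕ) :
    ∫ t in (s + i / N)..(s + (i + 1) / N), (x - t) ^ 2 =
      (x - s - (i + 1 / 2) / N) ^ 2 / N + 1 / (12 * N ^ 3) := by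
  have hN' : (N : ℝ) ≠ 0 := by positivity
  rw [intervalIntegral.integral_comp_sub_left (fun t => t ^ 2) x, integral_pow]
  push_cast
  field_simp
  ring

lemma sum_abs_sub_of_monotone {N : ℕ} {x : Fin N → ℝ} (hx : Monotone x) :
    ∑ i, ∑ j, |x i - x j| = 2 * ∑ i : Fin N, x i * (2 * i + 1 - N) := by
  let e (i j : Fin N) : ℝ := (if j < i then 1 else 0) - (if i < j then 1 else 0)
  have he (i j) : |x i - x j| = e i j * x i + e j i * x j := by
    rcases lt_trichotomy i j with h | rfl | h
    · have := hx h.le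
      simp only [e, h, h.not_gt, if_true, if_false]
      rw [abs_of_nonpos (by linarith)]; ring
    · simp [e]
    · have := hx h.le
      simp only [e, h, h.not_gt, if_true, if_false]
      rw [abs_of_nonneg (by linarith)]; ring
  have hs (i : Fin N) : ∑ j, e i j = 2 * i + 1 - N := by
    simp only [e, Finset.sum_sub_distrib, Finset.sum_boole]
    have h1 : (Finset.univ.filter fun j => j < i).card = i := by
      rw [← Fin.card_Iio i]; congr 1; ext; simp
    have h2 : (Finset.univ.filter fun j => i < j).card = N - 1 - i := by
      rw [← Fin.card_Ioi i]; congr 1; ext; simp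
    rw [h1, h2, Nat.sub_sub, Nat.cast_sub (by omega)]
    push_cast; ring
  simp only [he, Finset.sum_add_distrib]
  rw [Finset.sum_comm (f := fun i j => e j i * x j), two_mul]
  simp only [← Finset.sum_mul, hs, mul_comm (x _)]

lemma sum_cost_eq {N : ℕ} (hN : 0 < N) {x : Fin N → ℝ} (hx : Monotone x) (s : ℝ)
    (hs : s = (∑ i, x i) / N - 1 / 2) :
    ∑ i : Fin N, ((x i - s - (i + 1 / 2) / N) ^ 2 / N + 1 / (12 * (N : ℝ) ^ 3)) =
      (∑ i, ∑ j, (|x i - x j| ^ 2 - |x i - x j| + 6⁻¹)) / (2 * (N : ℝ) ^ 2) := by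
  have hN' : (N : ℝ) ≠ 0 := by positivity
  have hi (n : ℕ) : ∑ i ∈ Finset.range n, (i : ℝ) = n * (n - 1) / 2 := by
    induction n with
    | zero => simp
    | succ n ih => rw [Finset.sum_range_succ, ih]; push_cast; ring
  have hi2 (n : ℕ) : ∑ i ∈ Finset.range n, (i : ℝ) ^ 2 = n * (n - 1) * (2 * n - 1) / 6 := by
    induction n with
    | zero => simp
    | succ n ih => rw [Finset.sum_range_succ, ih]; push_cast; ring
  have hI : ∑ i : Fin N, (i : ℝ) = N * (N - 1) / 2 := by
    rw [← hi, Fin.sum_univ_eq_sum_range (fun i => (i : ℝ))]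
  have hI2 : ∑ i : Fin N, (i : ℝ) ^ 2 = N * (N - 1) * (2 * N - 1) / 6 := by
    rw [← hi2, Fin.sum_univ_eq_sum_range (fun i => (i : ℝ) ^ 2)]
  have hL : ∑ i : Fin N, ((x i - s - (i + 1 / 2) / N) ^ 2 / N + 1 / (12 * (N : ℝ) ^ 3)) =
      (∑ i, x i ^ 2) / N + (s ^ 2 + s / N + 1 / (4 * N ^ 2) + 1 / (12 * N ^ 2))
        - (2 * s / N + 1 / N ^ 2) * (∑ i, x i) - 2 / N ^ 2 * (∑ i : Fin N, x i * i)
        + (2 * s / N ^ 2 + 1 / N ^ 3) * (∑ i : Fin N, (i : ℝ))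
        + 1 / N ^ 3 * ∑ i : Fin N, (i : ℝ) ^ 2 := by
    have hc : (s ^ 2 + s / N + 1 / (4 * N ^ 2) + 1 / (12 * N ^ 2) : ℝ) =
        ∑ i : Fin N, (s ^ 2 + s / N + 1 / (4 * N ^ 2) + 1 / (12 * N ^ 2)) / N := by
      simp; field_simp
    rw [hc]
    simp only [Finset.sum_div, Finset.mul_sum, ← Finset.sum_add_distrib, ← Finset.sum_sub_distrib]
    refine Finset.sum_congr rfl fun i _ => ?_
    field_simp
    ring
  have hR : ∑ i, ∑ j, (|x i - x j| ^ 2 - |x i - x j| + 6⁻¹) =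
      2 * N * (∑ i, x i ^ 2) - 2 * (∑ i, x i) ^ 2
        - 2 * (2 * (∑ i : Fin N, x i * i) + (1 - N) * ∑ i, x i) + N ^ 2 / 6 := by
    have h1 : ∑ i, ∑ j, |x i - x j| ^ 2 = 2 * N * (∑ i, x i ^ 2) - 2 * (∑ i, x i) ^ 2 := by
      simp only [sq_abs, sub_sq, Finset.sum_add_distrib, Finset.sum_sub_distrib, Finset.sum_const,
        Finset.card_univ, Fintype.card_fin, nsmul_eq_mul, ← Finset.mul_sum, ← Finset.sum_mul]
      ring
    have h2 : ∑ i : Fin N, x i * (2 * i + 1 - N) =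
        2 * (∑ i : Fin N, x i * i) + (1 - N) * ∑ i, x i := by
      simp only [Finset.mul_sum, ← Finset.sum_add_distrib]
      exact Finset.sum_congr rfl fun i _ => by ring
    simp only [Finset.sum_add_distrib, Finset.sum_sub_distrib] at *
    rw [h1, sum_abs_sub_of_monotone hx, h2]
    simp
    ring
  rw [hL, hR, hI, hI2, hs]
  field_simp
  ring

lemma Wdist_two_le_sqrt_sum {N : ℕ} (hN : 0 < N) (x : Fin N → ℝ) :
    Wdist 2 ((N : ℝ≥0∞)⁻¹ • ∑ i, Measure.dirac (x i : UnitAddCircle)) volume ≤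
      √((∑ i, ∑ j, (|x i - x j| ^ 2 - |x i - x j| + 6⁻¹)) / (2 * (N : ℝ) ^ 2)) := by
  let σ := Tuple.sort x
  have h := Wdist_two_sq_le hN (x ∘ σ) ((∑ i, (x ∘ σ) i) / N - 1 / 2)
  simp only [integral_sub_sq_div N hN] at h
  rw [sum_cost_eq hN (Tuple.monotone_sort x) _ rfl] at h
  simp only [Function.comp] at h
  rw [Equiv.sum_comp σ (fun i => Measure.dirac (x i : UnitAddCircle)),
    Equiv.sum_comp σ (fun i => ∑ j, (|x i - x (σ j)| ^ 2 - |x i - x (σ j)| + 6⁻¹))] at h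
  simpa only [fun i => Equiv.sum_comp σ (fun j => (|x i - x j| ^ 2 - |x i - x j| + 6⁻¹))] using h

lemma hasSum_cos_div_sq {d : ℝ} (hd : |d| ≤ 1) :
    HasSum (fun h : ℕ => 1 / (h : ℝ) ^ 2 * Real.cos (2 * Real.pi * h * d))
      (Real.pi ^ 2 * (|d| ^ 2 - |d| + 6⁻¹)) := by
  have h := hasSum_one_div_nat_pow_mul_cos one_ne_zero (x := |d|) ⟨abs_nonneg d, hd⟩
  have hB := bernoulliFun_two |d|
  rw [bernoulliFun] at hB
  rw [mul_one, hB] at h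
  convert h using 1
  · ext n
    rcases abs_cases d with ⟨h, -⟩ | ⟨h, -⟩ <;> rw [h]
    rw [mul_neg, Real.cos_neg]
  · simp only [Nat.factorial]
    push_cast
    ring

lemma hasSum_norm_exp_sum {ι : Type*} [Fintype ι] {x : ι → ℝ} (hx : ∀ i j, |x i - x j| ≤ 1) :
    HasSum (fun h : ℕ => 1 / (h : ℝ) ^ 2 *
        ‖∑ i, Complex.exp (Complex.I * (2 * Real.pi * h * x i : ℝ))‖ ^ 2)
      (Real.pi ^ 2 * ∑ i, ∑ j, (|x i - x j| ^ 2 - |x i - x j| + 6⁻¹)) := by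
  have h := hasSum_sum (s := Finset.univ) fun i _ =>
    hasSum_sum (s := Finset.univ) fun j _ => hasSum_cos_div_sq (hx i j)
  simp only [← Finset.mul_sum] at h
  convert h using 3 with n
  rw [← Complex.normSq_eq_norm_sq, Complex.normSq_apply, Complex.re_sum, Complex.im_sum,
    Finset.sum_mul_sum, Finset.sum_mul_sum, ← Finset.sum_add_distrib]
  refine Finset.sum_congr rfl fun i _ => ?_
  rw [← Finset.sum_add_distrib]
  refine Finset.sum_congr rfl fun j _ => ?_
  simp only [mul_comm Complex.I, Complex.exp_ofReal_mul_I_re, Complex.exp_ofReal_mul_I_im]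
  rw [mul_sub, Real.cos_sub]

lemma norm_exp_sum_mul_le (α : ℝ) (N h : ℕ) :
    ‖∑ i : Fin N, Complex.exp
      (Complex.I * (2 * Real.pi * h * Int.fract (((i : ℕ) + 1 : ℕ) * α) : ℝ))‖ *
        |h * α - round (h * α)| ≤ 1 := by
  set y : ℝ := h * α - round (h * α) with hy
  set z : ℂ := Complex.exp (Complex.I * (2 * Real.pi * y : ℝ)) with hz
  have hterm (n : ℕ) :
      Complex.exp (Complex.I * (2 * Real.pi * h * Int.fract (n * α) : ℝ)) = z ^ n := by
    rw [hz, ← Complex.exp_nat_mul, Complex.exp_eq_exp_iff_exists_int]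
    refine ⟨n * round (h * α) - h * ⌊n * α⌋, ?_⟩
    rw [hy, Int.fract]
    push_cast
    ring
  have hzn : ‖z‖ = 1 := by rw [hz, mul_comm, Complex.norm_exp_ofReal_mul_I]
  have hgeom : (∑ i : Fin N, z ^ ((i : ℕ) + 1)) * (z - 1) = z * (z ^ N - 1) := by
    rw [Fin.sum_univ_eq_sum_range (fun i => z ^ (i + 1)), ← geom_sum_mul, ← mul_assoc,
      Finset.mul_sum]
    simp only [pow_succ']
  have hz1 : 4 * |y| ≤ ‖z - 1‖ := by
    have hy2 : |y| ≤ 1 / 2 := abs_sub_round _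
    rw [hz, Complex.norm_exp_I_mul_ofReal_sub_one, norm_mul, Real.norm_eq_abs, Real.norm_eq_abs,
      show 2 * Real.pi * y / 2 = Real.pi * y by ring]
    have h1 : |Real.pi * y| = Real.pi * |y| := by rw [abs_mul, abs_of_pos Real.pi_pos]
    have h2 := Real.mul_abs_le_abs_sin (x := Real.pi * y) (by
      rw [h1]; nlinarith [Real.pi_pos])
    rw [h1, ← mul_assoc, div_mul_cancel₀ _ Real.pi_ne_zero] at h2
    rw [abs_two]
    linarith
  have hz2 : ‖z ^ N - 1‖ ≤ 2 := by
    refine (norm_sub_le _ _).trans ?_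
    rw [norm_pow, hzn]; norm_num
  simp only [hterm]
  have h3 := congrArg norm hgeom
  rw [norm_mul, norm_mul, hzn, one_mul] at h3
  nlinarith [norm_nonneg (∑ i : Fin N, z ^ ((i : ℕ) + 1))]

/-- A weighted sum over a short range of integers is controlled by the
spacing of the multiples of `α` modulo one. -/
lemma sum_le_of_badly_approximable {α c : ℝ} (hc : 0 < c)
    (hα : ∀ p : ℤ, ∀ q : ℕ, 1 ≤ q → c ≤ q * |q * α - p|) {A L : ℝ} (hA : 0 ≤ A) (hL : 0 < L)
    {G : ℕ → ℝ} (s : Finset ℕ) (hs : ∀ h ∈ s, ∀ k ∈ s, h < k → (k : ℝ) ≤ h + L)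
    (hG0 : ∀ h ∈ s, 0 ≤ G h) (hGA : ∀ h ∈ s, G h ≤ A * L ^ 2)
    (hGy : ∀ h ∈ s, G h * (h * α - round (h * α)) ^ 2 ≤ 1) :
    ∑ h ∈ s, G h ≤ (2 / c ^ 2 + 3 * A) * (∑' m : ℤ, 1 / ((m : ℝ) ^ 2 + 1)) * L ^ 2 := by
  let y (h : ℕ) : ℝ := h * α - round (h * α)
  let b (h : ℕ) : ℤ := ⌊y h * L / c⌋
  have hsum : Summable fun m : ℤ => 1 / ((m : ℝ) ^ 2 + 1) := by
    have h1 : Summable fun m : ℤ => 1 / (m : ℝ) ^ 2 := Real.summable_one_div_int_pow.2 (by norm_num)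
    refine .of_norm_bounded_eventually h1 ?_
    filter_upwards [(Set.finite_singleton (0 : ℤ)).compl_mem_cofinite] with m hm
    have : (m : ℝ) ≠ 0 := by exact_mod_cast hm
    rw [Real.norm_of_nonneg (by positivity)]
    gcongr
    linarith
  have hsep (h k : ℕ) (hh : h ∈ s) (hk : k ∈ s) (hlt : h < k) : c / L ≤ |y k - y h| := by
    have h1 := hα (round (k * α) - round (h * α)) (k - h) (by omega)
    rw [Nat.cast_sub hlt.le] at h1
    have h2 := hs h hh k hk hlt
    have h3 : ((k : ℝ) - h) * α - ((round (k * α) - round (h * α) : ℤ) : ℝ) = y k - y h := by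
      simp only [y]; push_cast; ring
    rw [h3] at h1
    rw [div_le_iff₀ hL]
    nlinarith [abs_nonneg (y k - y h)]
  have hne (h k : ℕ) (hh : h ∈ s) (hk : k ∈ s) (hlt : h < k) : b h ≠ b k := by
    intro hb
    have h1 := Int.abs_sub_lt_one_of_floor_eq_floor hb.symm
    have h2 := hsep h k hh hk hlt
    rw [← sub_div, ← sub_mul, abs_div, abs_mul, abs_of_pos hL, abs_of_pos hc, div_lt_one hc] at h1
    rw [div_le_iff₀ hL] at h2
    linarith
  have hinj : Set.InjOn b s := by
    intro h hh k hk hb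
    rcases lt_trichotomy h k with hlt | rfl | hlt
    · exact absurd hb (hne h k hh hk hlt)
    · rfl
    · exact absurd hb.symm (hne k h hk hh hlt)
  have hterm (h : ℕ) (hh : h ∈ s) :
      G h ≤ (2 / c ^ 2 + 3 * A) * L ^ 2 * (1 / ((b h : ℝ) ^ 2 + 1)) := by
    rw [mul_one_div, le_div_iff₀ (by positivity)]
    have hG := hG0 h hh
    set t : ℝ := y h * L / c with ht
    have hb1 : (b h : ℝ) ≤ t := Int.floor_le _
    have hb2 : t < b h + 1 := Int.lt_floor_add_one _
    have hbt : (b h : ℝ) ^ 2 + 1 ≤ 2 * t ^ 2 + 3 := by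
      nlinarith [sq_nonneg ((b h : ℝ) - 2 * t)]
    have h4 : G h * t ^ 2 ≤ L ^ 2 / c ^ 2 := by
      have : G h * t ^ 2 = G h * y h ^ 2 * (L ^ 2 / c ^ 2) := by rw [ht]; field_simp
      rw [this]
      exact mul_le_of_le_one_left (by positivity) (hGy h hh)
    calc G h * ((b h : ℝ) ^ 2 + 1) ≤ G h * (2 * t ^ 2 + 3) := by gcongr
      _ = 2 * (G h * t ^ 2) + 3 * G h := by ring
      _ ≤ 2 * (L ^ 2 / c ^ 2) + 3 * (A * L ^ 2) := by gcongr; exact hGA h hh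
      _ = _ := by ring
  calc ∑ h ∈ s, G h
      ≤ ∑ h ∈ s, (2 / c ^ 2 + 3 * A) * L ^ 2 * (1 / ((b h : ℝ) ^ 2 + 1)) :=
        Finset.sum_le_sum hterm
    _ = (2 / c ^ 2 + 3 * A) * L ^ 2 * ∑ m ∈ s.image b, 1 / ((m : ℝ) ^ 2 + 1) := by
        rw [Finset.sum_image hinj, Finset.mul_sum]
    _ ≤ (2 / c ^ 2 + 3 * A) * L ^ 2 * ∑' m : ℤ, 1 / ((m : ℝ) ^ 2 + 1) := by
        gcongr
        exact hsum.sum_le_tsum _ fun m _ => by positivity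
    _ = _ := by ring

lemma sum_div_sq_le_of_badly_approximable {α c : ℝ} (hc : 0 < c)
    (hα : ∀ p : ℤ, ∀ q : ℕ, 1 ≤ q → c ≤ q * |q * α - p|) :
    ∃ B : ℝ, ∀ (K : ℕ) (G : ℕ → ℝ), 1 ≤ K → (∀ h, 0 ≤ G h) →
      (∀ h, G h ≤ 4 * ((2 : ℝ) ^ K) ^ 2) → (∀ h : ℕ, G h * (h * α - round (h * α)) ^ 2 ≤ 1) →
      ∀ s : Finset ℕ, ∑ h ∈ s, 1 / (h : ℝ) ^ 2 * G h ≤ B * K := by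
  set A : ℝ := 4 + 4 / c ^ 2 with hA
  set B : ℝ := (2 / c ^ 2 + 3 * A) * ∑' m : ℤ, 1 / ((m : ℝ) ^ 2 + 1) with hB
  have hA0 : 0 ≤ A := by positivity
  have hB0 : 0 ≤ B := mul_nonneg (by positivity) (tsum_nonneg fun m => by positivity)
  refine ⟨3 * B, fun K G hK hG0 hGN hGy s => ?_⟩
  have hblock (a L : ℕ) (ha : 0 < a) (hL : 0 < L) (hGA : ∀ h ∈ Finset.Ico a (a + L),
      G h ≤ A * (L : ℝ) ^ 2) :
      ∑ h ∈ Finset.Ico a (a + L), 1 / (h : ℝ) ^ 2 * G h ≤ B * ((L : ℝ) / a) ^ 2 := by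
    have h1 := sum_le_of_badly_approximable hc hα hA0 (L := L) (by exact_mod_cast hL)
      (Finset.Ico a (a + L)) (fun h hh k hk _ => by
        rw [Finset.mem_Ico] at hh hk
        exact_mod_cast (by omega : k ≤ h + L)) (fun h _ => hG0 h) hGA (fun h _ => hGy h)
    calc ∑ h ∈ Finset.Ico a (a + L), 1 / (h : ℝ) ^ 2 * G h
        ≤ ∑ h ∈ Finset.Ico a (a + L), 1 / (a : ℝ) ^ 2 * G h := by
          refine Finset.sum_le_sum fun h hh => ?_
          rw [Finset.mem_Ico] at hh
          have := hG0 h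
          have : (a : ℝ) ≤ h := by exact_mod_cast hh.1
          gcongr
      _ ≤ 1 / (a : ℝ) ^ 2 * (B * (L : ℝ) ^ 2) := by
          rw [← Finset.mul_sum]
          gcongr
      _ = _ := by field_simp
  have hlow (k : ℕ) : ∑ h ∈ Finset.Ico (1 : ℕ) (2 ^ k), 1 / (h : ℝ) ^ 2 * G h ≤ B * k := by
    induction k with
    | zero => simp
    | succ k ih =>
      rw [pow_succ, mul_two, ← Finset.sum_Ico_consecutive _ (Nat.one_le_two_pow (n := k))
        (Nat.le_add_left _ _)]
      have h1 := hblock (2 ^ k) (2 ^ k) (by positivity) (by positivity) fun h hh => by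
        rw [Finset.mem_Ico] at hh
        have h2 := hα (round (h * α)) h (Nat.one_le_two_pow.trans hh.1)
        have h3 : (h : ℝ) ≤ 2 * (2 ^ k : ℕ) := by exact_mod_cast (by omega : h ≤ 2 * 2 ^ k)
        have h4 : c ^ 2 ≤ (2 * (2 ^ k : ℕ)) ^ 2 * (h * α - round (h * α)) ^ 2 := by
          rw [← sq_abs ((h : ℝ) * α - _), ← mul_pow]
          exact pow_le_pow_left₀ hc.le (h2.trans (by gcongr)) 2
        have h5 : G h * c ^ 2 ≤ 4 * ((2 ^ k : ℕ) : ℝ) ^ 2 := by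
          calc G h * c ^ 2
              ≤ G h * ((2 * (2 ^ k : ℕ)) ^ 2 * (h * α - round (h * α)) ^ 2) := by
                gcongr; exact hG0 h
            _ = 4 * ((2 ^ k : ℕ) : ℝ) ^ 2 * (G h * (h * α - round (h * α)) ^ 2) := by ring
            _ ≤ _ := mul_le_of_le_one_right (by positivity) (hGy h)
        calc G h ≤ 4 * ((2 ^ k : ℕ) : ℝ) ^ 2 / c ^ 2 := by rwa [le_div_iff₀ (by positivity)]
          _ = 4 / c ^ 2 * ((2 ^ k : ℕ) : ℝ) ^ 2 := by ring
          _ ≤ A * ((2 ^ k : ℕ) : ℝ) ^ 2 := by gcongr; linarith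
      rw [div_self (by positivity)] at h1
      push_cast
      linarith
  have hGK (h : ℕ) : G h ≤ A * ((2 ^ K : ℕ) : ℝ) ^ 2 := by
    push_cast
    refine (hGN h).trans ?_
    gcongr
    have : 0 ≤ 4 / c ^ 2 := by positivity
    linarith
  have hhigh (J : ℕ) : ∑ h ∈ Finset.Ico ((2 : ℕ) ^ K) (2 ^ K * (J + 2)), 1 / (h : ℝ) ^ 2 * G h ≤
      B * (2 - 1 / (J + 1)) := by
    induction J with
    | zero =>
      have h1 := hblock (2 ^ K) (2 ^ K) (by positivity) (by positivity) fun h _ => hGK h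
      rw [div_self (by positivity)] at h1
      rw [zero_add, mul_two]
      refine h1.trans (le_of_eq ?_)
      norm_num
    | succ J ih =>
      have h1 := hblock (2 ^ K * (J + 2)) (2 ^ K) (by positivity) (by positivity) fun h _ => hGK h
      rw [show 2 ^ K * (J + 1 + 2) = 2 ^ K * (J + 2) + 2 ^ K by ring,
        ← Finset.sum_Ico_consecutive _ (Nat.le_mul_of_pos_right _ (by omega))
          (Nat.le_add_right _ _)]
      have h2 : ((2 ^ K : ℕ) / (2 ^ K * (J + 2) : ℕ) : ℝ) ^ 2 ≤
          1 / (J + 1) - 1 / ((J + 1 : ℕ) + 1) := by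
        have : ((2 ^ K : ℕ) / (2 ^ K * (J + 2) : ℕ) : ℝ) = 1 / (J + 2) := by
          push_cast; field_simp
        rw [this]
        push_cast
        rw [div_sub_div _ _ (by positivity) (by positivity), div_pow,
          div_le_div_iff₀ (by positivity) (by positivity)]
        have : (0 : ℝ) ≤ J := by positivity
        nlinarith
      nlinarith [mul_le_mul_of_nonneg_left h2 hB0]
  obtain ⟨M, hM⟩ := s.exists_nat_subset_range
  have hpow : 0 < 2 ^ K := by positivity
  have hsub : s ⊆ Finset.range (2 ^ K * (M + 2)) :=
    hM.trans (Finset.range_subset_range.2 (by nlinarith))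
  refine (Finset.sum_le_sum_of_subset_of_nonneg hsub fun h _ _ =>
    mul_nonneg (by positivity) (hG0 h)).trans ?_
  rw [Finset.range_eq_Ico, ← Finset.sum_Ico_consecutive _ (Nat.zero_le 1) (by nlinarith),
    ← Finset.sum_Ico_consecutive _ (Nat.one_le_two_pow (n := K)) (by nlinarith)]
  have h1 := hlow K
  have h2 := hhigh M
  have h3 : B * (2 - 1 / (M + 1)) ≤ B * 2 := by
    gcongr
    have : (0 : ℝ) ≤ 1 / (M + 1) := by positivity
    linarith
  have h4 : B * 1 ≤ B * K := by
    gcongr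
    exact_mod_cast hK
  simp only [Nat.Ico_succ_singleton, Finset.sum_singleton, Nat.cast_zero]
  norm_num at *
  linarith

/-- Theorem 3 of the paper: for badly approximable `α`, the Kronecker sequence
satisfies `W₂(μ_N, dx) ≤ C √(log N)/N`. -/
theorem stmt4 (α : ℝ) (hα : BadlyApproximable α) : ∃ C : ℝ, 0 < C ∧
    ∀ N : ℕ, 2 ≤ N →
      Wdist 2 (kroneckerMeasure α N) volume ≤ C * Real.sqrt (Real.log N) / N := by
  obtain ⟨c, hc, hα⟩ := hα
  have hα' (p : ℤ) (q : ℕ) (hq : 1 ≤ q) : c ≤ q * |q * α - p| := by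
    have hq' : (0 : ℝ) < q := by exact_mod_cast hq
    have h1 := hα p q hq
    rw [div_le_iff₀ (by positivity)] at h1
    have h2 : (q : ℝ) * α - p = q * (α - p / q) := by field_simp
    rw [h2, abs_mul, abs_of_pos hq']
    linarith
  obtain ⟨B, hB⟩ := sum_div_sq_le_of_badly_approximable hc hα'
  have hlog2 : 0 < Real.log 2 := Real.log_pos one_lt_two
  set D : ℝ := |B| / (Real.log 2 * Real.pi ^ 2 * 2) with hD
  have hD0 : 0 ≤ D := by positivity
  refine ⟨√D + 1, by positivity, fun N hN => ?_⟩
  have hN0 : (0 : ℝ) < N := by positivity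
  set x : Fin N → ℝ := fun i => Int.fract (((i : ℕ) + 1 : ℕ) * α) with hx
  have hμ : kroneckerMeasure α N =
      (N : ℝ≥0∞)⁻¹ • ∑ i, Measure.dirac (x i : UnitAddCircle) := by
    have hcoe (y : ℝ) : ((Int.fract y : ℝ) : UnitAddCircle) = y := AddCircle.coe_fract y
    simp only [kroneckerMeasure, hx, hcoe]
    rw [Fin.sum_univ_eq_sum_range
      (fun i => Measure.dirac ((((i + 1 : ℕ) : ℝ) * α : ℝ) : UnitAddCircle)),
      Finset.range_eq_Ico, Finset.sum_Ico_add' (fun i : ℕ =>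
        Measure.dirac (((i : ℝ) * α : ℝ) : UnitAddCircle)) 0 N 1]
    rfl
  have hx1 (i j : Fin N) : |x i - x j| ≤ 1 := by
    rw [abs_le]
    constructor <;> linarith [Int.fract_nonneg (((i : ℕ) + 1 : ℕ) * α),
      Int.fract_lt_one (((i : ℕ) + 1 : ℕ) * α), Int.fract_nonneg (((j : ℕ) + 1 : ℕ) * α),
      Int.fract_lt_one (((j : ℕ) + 1 : ℕ) * α)]
  have hK : 1 ≤ Nat.log 2 N := Nat.log_pos one_lt_two hN
  have hVK := hasSum_le_of_sum_le (hasSum_norm_exp_sum hx1) <|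
    hB (Nat.log 2 N) _ hK (fun h => by positivity) (fun h => ?_) (fun h => ?_)
  · have hKlog : (Nat.log 2 N : ℝ) ≤ Real.log N / Real.log 2 := by
      rw [le_div_iff₀ hlog2, ← Real.log_pow]
      exact Real.log_le_log (by positivity) (by exact_mod_cast Nat.pow_log_le_self 2 (by omega))
    rw [hμ]
    refine (Wdist_two_le_sqrt_sum (by omega) x).trans ?_
    have hlogN : 0 ≤ Real.log N := Real.log_natCast_nonneg N
    calc √((∑ i, ∑ j, (|x i - x j| ^ 2 - |x i - x j| + 6⁻¹)) / (2 * (N : ℝ) ^ 2))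
        ≤ √(D * Real.log N / (N : ℝ) ^ 2) := by
          refine Real.sqrt_le_sqrt ?_
          rw [mul_comm, ← le_div_iff₀ (by positivity)] at hVK
          calc _ ≤ (B * Nat.log 2 N / Real.pi ^ 2) / (2 * (N : ℝ) ^ 2) := by gcongr
            _ ≤ (|B| * (Real.log N / Real.log 2) / Real.pi ^ 2) / (2 * (N : ℝ) ^ 2) := by
              gcongr
              exact le_abs_self B
            _ = _ := by rw [hD]; field_simp
      _ = √D * √(Real.log N) / N := by
          rw [Real.sqrt_div (by positivity), Real.sqrt_mul hD0, Real.sqrt_sq hN0.le]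
      _ ≤ (√D + 1) * √(Real.log N) / N := by gcongr; linarith
  · have h1 : ‖∑ i, Complex.exp (Complex.I * (2 * Real.pi * h * x i : ℝ))‖ ≤ N := by
      refine (norm_sum_le _ _).trans ?_
      simp only [mul_comm Complex.I, Complex.norm_exp_ofReal_mul_I]
      simp
    have h2 : (N : ℝ) ≤ 2 * 2 ^ Nat.log 2 N := by
      have := Nat.lt_pow_succ_log_self one_lt_two N
      rw [pow_succ'] at this
      exact_mod_cast this.le
    calc _ ≤ (2 * (2 : ℝ) ^ Nat.log 2 N) ^ 2 :=
          pow_le_pow_left₀ (norm_nonneg _) (h1.trans h2) 2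
      _ = _ := by ring
  · rw [← sq_abs ((h : ℝ) * α - _), ← mul_pow]
    exact pow_le_one₀ (by positivity) (norm_exp_sum_mul_le α N h)
end

section
/- There is an absolute constant C > 0 such that for every odd prime p, the normalized counting measure μ_p = (1/p) Σ_{n=1}^{p} δ_{{n²/p}} of the rescaled quadratic residues satisfies W₂(μ_p, dx) ≤ C / √p. -/
open MeasureTheory
open scoped ENNReal

/-- The normalized counting measure `(1/p) ∑_{n=1}^p δ_{{n²/p}}` of the rescaled
quadratic residues mod `p`, viewed on the torus `𝕋 = ℝ/ℤ`. -/
noncomputable def qrMeasure (p : ℕ) : Measure UnitAddCircle :=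
  (p : ℝ≥0∞)⁻¹ • ∑ n ∈ Finset.Icc 1 p, Measure.dirac (((n : ℝ) ^ 2 / (p : ℝ) : ℝ) : UnitAddCircle)

open Finset

section QuadraticResidues
variable {p : ℕ} [Fact p.Prime]

lemma ZMod.sum_range_add_natCast {M : Type*} [AddCommMonoid M] (f : ZMod p → M) (j : ZMod p) :
    ∑ i ∈ range p, f (j + i) = ∑ x, f x := by
  rw [← Equiv.sum_comp (Equiv.addLeft j) f]
  refine Finset.sum_bij (fun i _ => (i : ZMod p)) (by simp) ?_ ?_ (by simp)
  · intro a ha b hb h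
    rw [ZMod.natCast_eq_natCast_iff'] at h
    rwa [Nat.mod_eq_of_lt (mem_range.1 ha), Nat.mod_eq_of_lt (mem_range.1 hb)] at h
  · intro b _
    exact ⟨b.val, mem_range.2 (ZMod.val_lt b), ZMod.natCast_zmod_val b⟩

lemma sum_quadraticChar_mul_shift (hp : p ≠ 2) (a b : ZMod p) :
    ∑ x, quadraticChar (ZMod p) (x + a) * quadraticChar (ZMod p) (x + b) =
      (if a = b then (p : ℤ) else 0) - 1 := by
  have hF : ringChar (ZMod p) ≠ 2 := by rwa [ZMod.ringChar_zmod_n]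
  split_ifs with h
  · subst h
    refine (Equiv.sum_comp (Equiv.addRight a)
      (fun x => quadraticChar (ZMod p) x * quadraticChar (ZMod p) x)).trans ?_
    have h1 : ∀ x : ZMod p, quadraticChar (ZMod p) x * quadraticChar (ZMod p) x =
        1 - if x = 0 then 1 else 0 := by
      intro x
      by_cases hx : x = 0
      · simp [hx]
      · rw [← sq, quadraticChar_sq_one hx, if_neg hx, sub_zero]
    rw [sum_congr rfl fun x _ => h1 x]
    simp
  · have hd : a - b ≠ 0 := sub_ne_zero.2 h
    have key := jacobiSum_nontrivial_inv (quadraticChar_ne_one hF)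
    rw [(quadraticChar_isQuadratic (ZMod p)).inv, jacobiSum] at key
    rw [← Equiv.sum_comp ((Equiv.mulLeft₀ (a - b) hd).trans (Equiv.addRight (-a)))
      (fun x => quadraticChar (ZMod p) (x + a) * quadraticChar (ZMod p) (x + b))]
    have h2 : ∀ x : ZMod p, quadraticChar (ZMod p) ((a - b) * x + -a + a) *
        quadraticChar (ZMod p) ((a - b) * x + -a + b) =
        quadraticChar (ZMod p) (-1) *
          (quadraticChar (ZMod p) x * quadraticChar (ZMod p) (1 - x)) := by
      intro x
      have e : (a - b) * x + -a + b = (-1) * ((a - b) * (1 - x)) := by ring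
      rw [e, neg_add_cancel_right, map_mul, map_mul, map_mul]
      linear_combination quadraticChar (ZMod p) (-1) * quadraticChar (ZMod p) x *
        quadraticChar (ZMod p) (1 - x) * quadraticChar_sq_one hd
    simp only [Equiv.trans_apply, Equiv.mulLeft₀_apply, Equiv.coe_addRight, h2]
    rw [← mul_sum, key]
    linear_combination -quadraticChar_sq_one (F := ZMod p) (neg_ne_zero.2 one_ne_zero)

/-- The sum of the quadratic character over the `a` consecutive residues starting at `j`. -/
noncomputable def quadCharSum (j : ZMod p) (a : ℕ) : ℤ :=
  ∑ i ∈ range a, quadraticChar (ZMod p) (j + i)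

lemma quadCharSum_self (hp : p ≠ 2) (j : ZMod p) : quadCharSum j p = 0 := by
  rw [quadCharSum, ZMod.sum_range_add_natCast]
  exact quadraticChar_sum_zero (by rwa [ZMod.ringChar_zmod_n])

lemma sum_quadCharSum_sq (hp : p ≠ 2) {a : ℕ} (ha : a ≤ p) :
    ∑ j : ZMod p, quadCharSum j a ^ 2 = a * (p - a) := by
  simp only [quadCharSum, sq, sum_mul_sum]
  rw [sum_comm]
  simp only [sum_comm (s := univ), sum_quadraticChar_mul_shift hp]
  have h : ∀ i ∈ range a, ∑ k ∈ range a,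
      ((if (i : ZMod p) = k then (p : ℤ) else 0) - 1) = p - a := by
    intro i hi
    have : ∀ k ∈ range a, ((if (i : ZMod p) = k then (p : ℤ) else 0) - 1) =
        (if i = k then (p : ℤ) else 0) - 1 := by
      intro k hk
      rw [mem_range] at hi hk
      simp only [ZMod.natCast_eq_natCast_iff', Nat.mod_eq_of_lt (hi.trans_le ha),
        Nat.mod_eq_of_lt (hk.trans_le ha)]
    rw [sum_congr rfl this, sum_sub_distrib, sum_ite_eq, if_pos hi]
    simp
  rw [sum_congr rfl h, sum_const, card_range, nsmul_eq_mul]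

lemma exists_sum_quadCharSum_sq_le (hp : p ≠ 2) :
    ∃ j : ZMod p, 4 * ∑ a ∈ range p, quadCharSum j a ^ 2 ≤ (p : ℤ) ^ 2 := by
  by_contra! h
  have h1 : ∑ _j : ZMod p, (p : ℤ) ^ 2 <
      ∑ j : ZMod p, 4 * ∑ a ∈ range p, quadCharSum j a ^ 2 :=
    sum_lt_sum_of_nonempty univ_nonempty fun j _ => h j
  rw [← mul_sum, sum_comm, mul_sum] at h1
  have h2 : ∑ a ∈ range p, 4 * ∑ j : ZMod p, quadCharSum j a ^ 2 ≤
      ∑ _a ∈ range p, (p : ℤ) ^ 2 := by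
    refine sum_le_sum fun a ha => ?_
    rw [sum_quadCharSum_sq hp (mem_range.1 ha).le]
    nlinarith [sq_nonneg ((p : ℤ) - 2 * a)]
  simp at h1 h2
  linarith

lemma qrMeasure_eq (hp : p ≠ 2) (j : ZMod p) :
    qrMeasure p = ∑ i ∈ range p,
      ENNReal.ofReal ((1 + quadraticChar (ZMod p) (j + i) : ℤ) / (p : ℝ)) •
        Measure.dirac (ZMod.toAddCircle (j + (i : ZMod p))) := by
  have hF : ringChar (ZMod p) ≠ 2 := by rwa [ZMod.ringChar_zmod_n]
  have hp0 : 0 < (p : ℝ) := by exact_mod_cast (Fact.out : p.Prime).pos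
  rw [ZMod.sum_range_add_natCast (fun x => ENNReal.ofReal
    ((1 + quadraticChar (ZMod p) x : ℤ) / (p : ℝ)) • Measure.dirac (ZMod.toAddCircle x))]
  have h1 : ∀ n : ℕ, (((n : ℝ) ^ 2 / (p : ℝ) : ℝ) : UnitAddCircle) =
      ZMod.toAddCircle ((n : ZMod p) ^ 2) := by
    intro n
    have := ZMod.toAddCircle_natCast (N := p) (n ^ 2)
    push_cast at this
    exact this.symm
  have h2 : ∑ n ∈ Icc 1 p, Measure.dirac (((n : ℝ) ^ 2 / (p : ℝ) : ℝ) : UnitAddCircle) =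
      ∑ x : ZMod p, Measure.dirac (ZMod.toAddCircle (x ^ 2)) := by
    rw [← ZMod.sum_range_add_natCast (fun x : ZMod p => Measure.dirac (ZMod.toAddCircle (x ^ 2))) 1,
      range_eq_Ico, ← Ico_add_one_right_eq_Icc, sum_Ico_eq_sum_range, sum_Ico_eq_sum_range]
    refine sum_congr (by simp) fun i _ => ?_
    rw [h1]
    simp
  rw [qrMeasure, h2, ← sum_fiberwise_of_maps_to (s := univ) (t := univ)
    (g := fun x : ZMod p => x ^ 2) (by simp), smul_sum]
  refine sum_congr rfl fun y _ => ?_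
  rw [sum_congr rfl (g := fun _ => Measure.dirac (ZMod.toAddCircle y))
    (fun x hx => by rw [(mem_filter.1 hx).2]), sum_const, ← Nat.cast_smul_eq_nsmul ℝ≥0∞, smul_smul]
  congr 1
  have hc := quadraticChar_card_sqrts hF y
  have hs : {x : ZMod p | x ^ 2 = y}.toFinset = univ.filter fun x => x ^ 2 = y := by
    ext; simp
  rw [hs] at hc
  rw [add_comm, ← hc, ENNReal.ofReal_div_of_pos hp0, ENNReal.ofReal_natCast, Int.cast_natCast,
    ENNReal.ofReal_natCast, mul_comm, div_eq_mul_inv]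

end QuadraticResidues

lemma AddCircle.dist_coe_le {T : ℝ} (x y : ℝ) :
    dist (x : AddCircle T) (y : AddCircle T) ≤ |x - y| := by
  rw [dist_eq_norm, ← AddCircle.coe_sub]
  exact QuotientAddGroup.norm_mk_le_norm

lemma MeasureTheory.Measure.sum_restrict_Ioc_consecutive (μ : Measure ℝ) {b : ℕ → ℝ}
    (hb : Monotone b) (n : ℕ) :
    ∑ i ∈ range n, μ.restrict (Set.Ioc (b i) (b (i + 1))) = μ.restrict (Set.Ioc (b 0) (b n)) := by
  induction n with
  | zero => simp
  | succ n ih =>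
    rw [sum_range_succ, ih, ← Measure.restrict_union
      (Set.disjoint_left.2 fun x hx hy => absurd hx.2 (not_le.2 hy.1)) measurableSet_Ioc,
      Set.Ioc_union_Ioc_eq_Ioc (hb n.zero_le) (hb n.le_succ)]

lemma Wdist_two_le {μ ν : Measure UnitAddCircle}
    (γ : Measure (UnitAddCircle × UnitAddCircle)) (h1 : γ.map Prod.fst = μ)
    (h2 : γ.map Prod.snd = ν) {c : ℝ} (hc : 0 ≤ c) (h : ∫ z, dist z.1 z.2 ^ (2 : ℝ) ∂γ ≤ c ^ 2) :
    Wdist 2 μ ν ≤ c := by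
  have hnn : ∀ γ : Measure (UnitAddCircle × UnitAddCircle),
      0 ≤ ∫ z, dist z.1 z.2 ^ (2 : ℝ) ∂γ :=
    fun γ => integral_nonneg fun z => Real.rpow_nonneg dist_nonneg _
  refine csInf_le_of_le ⟨0, ?_⟩ ⟨γ, h1, h2, rfl⟩ ?_
  · rintro _ ⟨γ', _, _, rfl⟩
    exact Real.rpow_nonneg (hnn _) _
  · rw [← Real.sqrt_eq_rpow]
    exact Real.sqrt_le_iff.2 ⟨hc, h⟩

/-- Points `x i` of the line receive the consecutive intervals `(b i, b (i + 1)]` partitioning a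
fundamental domain of the circle: the resulting coupling bounds the Wasserstein distance. -/
lemma Wdist_two_sum_dirac_le {b x : ℕ → ℝ} (hb : Monotone b) {n : ℕ} (hn : b n = b 0 + 1) {c : ℝ}
    (hc : 0 ≤ c)
    (h : ∑ i ∈ range n, ∫ y in b i..b (i + 1), (x i - y) ^ 2 ≤ c ^ 2) :
    Wdist 2 (∑ i ∈ range n, ENNReal.ofReal (b (i + 1) - b i) •
      Measure.dirac (x i : UnitAddCircle)) volume ≤ c := by
  have hm : ∀ i, Measurable fun y : ℝ => ((x i : UnitAddCircle), (y : UnitAddCircle)) :=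
    fun i => measurable_const.prodMk AddCircle.measurable_mk'
  have hcont : Continuous fun z : UnitAddCircle × UnitAddCircle => dist z.1 z.2 ^ (2 : ℝ) :=
    (continuous_fst.dist continuous_snd).rpow_const fun _ => Or.inr (by norm_num)
  refine Wdist_two_le (∑ i ∈ range n, (volume.restrict (Set.Ioc (b i) (b (i + 1)))).map
    fun y : ℝ => ((x i : UnitAddCircle), (y : UnitAddCircle))) ?_ ?_ hc ?_
  · rw [← Measure.mapₗ_apply_of_measurable measurable_fst, map_sum]
    refine sum_congr rfl fun i _ => ?_
    rw [Measure.mapₗ_apply_of_measurable measurable_fst, Measure.map_map measurable_fst (hm i)]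
    simp [Function.comp_def, Measure.map_const]
  · rw [← Measure.mapₗ_apply_of_measurable measurable_snd, map_sum,
      ← (AddCircle.measurePreserving_mk 1 (b 0)).map_eq, ← hn,
      ← Measure.sum_restrict_Ioc_consecutive volume hb,
      ← Measure.mapₗ_apply_of_measurable AddCircle.measurable_mk', map_sum]
    refine sum_congr rfl fun i _ => ?_
    rw [Measure.mapₗ_apply_of_measurable measurable_snd, Measure.map_map measurable_snd (hm i),
      Measure.mapₗ_apply_of_measurable AddCircle.measurable_mk']
    rfl
  · rw [integral_finsetSum_measure]
    · refine (sum_le_sum fun i _ => ?_).trans h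
      rw [integral_map (hm i).aemeasurable hcont.aestronglyMeasurable,
        intervalIntegral.integral_of_le (hb i.le_succ)]
      have hc2 : Continuous fun y : ℝ => (x i - y) ^ 2 := by fun_prop
      refine integral_mono_of_nonneg (ae_of_all _ fun y => Real.rpow_nonneg dist_nonneg _)
        (hc2.integrableOn_Ioc) (ae_of_all _ fun y => ?_)
      simp only [Real.rpow_two]
      rw [← sq_abs (x i - y)]
      exact pow_le_pow_left₀ dist_nonneg (AddCircle.dist_coe_le _ _) 2
    · intro i _
      rw [integrable_map_measure hcont.aestronglyMeasurable (hm i).aemeasurable]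
      refine Integrable.of_bound (C := 1) (hcont.measurable.comp (hm i)).aestronglyMeasurable
        (ae_of_all _ fun y => ?_)
      rw [Function.comp_apply, Real.norm_of_nonneg (Real.rpow_nonneg dist_nonneg _)]
      refine Real.rpow_le_one dist_nonneg ?_ (by norm_num)
      rw [dist_eq_norm]
      refine (AddCircle.norm_le_half_period 1 one_ne_zero).trans (by norm_num)

lemma Wdist_two_qrMeasure_le {p : ℕ} [Fact p.Prime] (hp : p ≠ 2) :
    Wdist 2 (qrMeasure p) volume ≤ 1 / √p := by
  have hp0 : 0 < (p : ℝ) := by exact_mod_cast (Fact.out : p.Prime).pos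
  obtain ⟨j, hj⟩ := exists_sum_quadCharSum_sq_le hp
  set D : ℕ → ℝ := fun i => (quadCharSum j i : ℝ) with hD
  have hD0 : D 0 = 0 := by simp [hD, quadCharSum]
  have hDp : D p = 0 := by simp [hD, quadCharSum_self hp]
  have hDs : ∀ i : ℕ, D (i + 1) = D i + (quadraticChar (ZMod p) (j + i) : ℤ) := by
    intro i
    simp [hD, quadCharSum, sum_range_succ]
  set b : ℕ → ℝ := fun i => (j.val + i + D i) / p with hb
  set x : ℕ → ℝ := fun i => (j.val + i) / p with hx
  have hbs : ∀ i : ℕ, b (i + 1) - b i = (1 + quadraticChar (ZMod p) (j + i) : ℤ) / (p : ℝ) := by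
    intro i
    simp only [hb, hDs]
    push_cast
    ring
  have hmono : Monotone b := by
    refine monotone_nat_of_le_succ fun i => sub_nonneg.1 ?_
    rw [hbs]
    refine div_nonneg (Int.cast_nonneg ?_) hp0.le
    rcases quadraticChar_isQuadratic (ZMod p) (j + i) with h | h | h <;> simp [h]
  have hxc : ∀ i, (x i : UnitAddCircle) = ZMod.toAddCircle (j + (i : ZMod p)) := by
    intro i
    have := ZMod.toAddCircle_natCast (N := p) (j.val + i)
    rw [Nat.cast_add, ZMod.natCast_zmod_val] at this
    rw [this]
    simp [hx]
  have hcost : ∀ i : ℕ, ∫ y in b i..b (i + 1), (x i - y) ^ 2 =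
      ((D (i + 1) + 1) ^ 3 - D i ^ 3) / (3 * p ^ 3) := by
    intro i
    have e1 : x i - b i = -D i / p := by
      simp only [hb, hx]
      ring
    have e2 : x i - b (i + 1) = -(D (i + 1) + 1) / p := by
      simp only [hb, hx]
      push_cast
      ring
    rw [intervalIntegral.integral_comp_sub_left (fun y => y ^ 2), integral_pow, e1, e2]
    norm_num
    field_simp
    ring
  rw [qrMeasure_eq hp j]
  simp only [← hbs, ← hxc]
  refine Wdist_two_sum_dirac_le hmono ?_ (by positivity) ?_
  · simp only [hb, hD0, hDp]
    field_simp
    simp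
  · rw [sum_congr rfl fun i _ => hcost i, ← sum_div, div_pow, Real.sq_sqrt hp0.le,
      div_le_div_iff₀ (by positivity) hp0]
    have h1 : ∑ i ∈ range p, ((D (i + 1) + 1) ^ 3 - D i ^ 3) =
        ∑ i ∈ range p, ((D i + 1) ^ 3 - D i ^ 3) := by
      have := sum_range_sub (fun i => (D i + 1) ^ 3) p
      rw [hD0, hDp, sub_self] at this
      rw [← sub_eq_zero, ← sum_sub_distrib, ← this]
      exact sum_congr rfl fun i _ => by ring
    have h2 : ∑ i ∈ range p, ((D i + 1) ^ 3 - D i ^ 3) ≤ ∑ i ∈ range p, (6 * D i ^ 2 + 1) := by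
      refine sum_le_sum fun i _ => ?_
      have : D i ≤ D i ^ 2 := by
        simp only [hD]
        exact_mod_cast Int.le_self_sq _
      nlinarith
    have h3 : 4 * ∑ i ∈ range p, D i ^ 2 ≤ (p : ℝ) ^ 2 := by
      simp only [hD]
      exact_mod_cast hj
    rw [sum_add_distrib, ← mul_sum] at h2
    simp only [sum_const, card_range, nsmul_eq_mul, mul_one] at h2
    have hp1 : (1 : ℝ) ≤ p := by exact_mod_cast (Fact.out : p.Prime).one_le
    have h4 : ∑ i ∈ range p, ((D (i + 1) + 1) ^ 3 - D i ^ 3) ≤ 3 * (p : ℝ) ^ 2 := by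
      nlinarith
    nlinarith [mul_le_mul_of_nonneg_right h4 hp0.le]

/-- For every odd prime `p`, the distribution of quadratic residues satisfies
`W₂(μ_p, dx) ≤ C/√p` for an absolute constant `C`. -/
theorem stmt8 : ∃ C : ℝ, 0 < C ∧
    ∀ p : ℕ, p.Prime → Odd p →
      Wdist 2 (qrMeasure p) volume ≤ C / Real.sqrt p := by
  refine ⟨1, one_pos, fun p hp hodd => ?_⟩
  have : Fact p.Prime := ⟨hp⟩
  exact Wdist_two_qrMeasure_le (by rintro rfl; exact absurd hodd (by decide))
end

section
/- There is an absolute constant C > 0 such that for every odd prime p, the normalized counting measure μ_p = (1/p) Σ_{n=1}^{p} δ_{{n²/p}} of the rescaled quadratic residues satisfies D(μ_p) ≤ C (log p) / √p. -/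
open MeasureTheory
open scoped ENNReal

/-- The discrepancy of a measure on the torus: the supremum over all arcs `J`
of `|μ(J) − |J||`, arcs being images of real intervals `[a,b)` with `b ≤ a+1`. -/
noncomputable def discrepancy (μ : Measure UnitAddCircle) : ℝ :=
  sSup { d : ℝ | ∃ a b : ℝ, a ≤ b ∧ b ≤ a + 1 ∧
    d = |(μ ((fun x : ℝ => (x : UnitAddCircle)) '' Set.Ico a b)).toReal - (b - a)| }

section QuadraticResidues

open Finset

theorem norm_geom_sum_le {z : ℂ} (hz : ‖z‖ = 1) (hz1 : z ≠ 1) (N : ℕ) :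
    ‖∑ i ∈ range N, z ^ i‖ ≤ 2 / ‖z - 1‖ := by
  rw [geom_sum_eq hz1, norm_div]
  gcongr
  calc ‖z ^ N - 1‖ ≤ ‖z ^ N‖ + ‖(1 : ℂ)‖ := norm_sub_le _ _
    _ = 2 := by rw [norm_pow, hz]; norm_num

theorem two_mul_le_sin_pi_mul {x : ℝ} (h0 : 0 ≤ x) (h1 : x ≤ 1) :
    2 * min x (1 - x) ≤ Real.sin (Real.pi * x) := by
  have hpi := Real.pi_pos
  rcases le_total x (1 / 2) with h | h
  · have := Real.mul_le_sin (x := Real.pi * x) (by positivity) (by nlinarith)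
    have e : 2 / Real.pi * (Real.pi * x) = 2 * x := by field_simp
    rw [min_eq_left (by linarith)]; linarith
  · have := Real.mul_le_sin (x := Real.pi * (1 - x)) (mul_nonneg hpi.le (by linarith))
      (by nlinarith)
    have e : 2 / Real.pi * (Real.pi * (1 - x)) = 2 * (1 - x) := by field_simp
    have e' : Real.sin (Real.pi * (1 - x)) = Real.sin (Real.pi * x) := by
      rw [mul_sub, mul_one, Real.sin_pi_sub]
    rw [min_eq_right (by linarith)]; linarith

theorem ZMod.two_div_norm_stdAddChar_sub_one_le {p : ℕ} [NeZero p] {a : ZMod p} (ha : a ≠ 0) :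
    2 / ‖ZMod.stdAddChar a - 1‖ ≤ (p : ℝ) / 2 * (1 / (a.val : ℝ) + 1 / ((p : ℝ) - a.val)) := by
  have hv : 0 < (a.val : ℝ) := by
    exact_mod_cast Nat.pos_of_ne_zero ((ZMod.val_ne_zero a).2 ha)
  have hp : 0 < (p : ℝ) := by exact_mod_cast NeZero.pos p
  have hlt : (a.val : ℝ) < p := by exact_mod_cast ZMod.val_lt a
  set x : ℝ := a.val / p with hx
  have hx0 : 0 < x := by positivity
  have hx1 : x < 1 := (div_lt_one hp).2 hlt
  have hmin : 0 < min x (1 - x) := lt_min hx0 (by linarith)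
  have hsin := two_mul_le_sin_pi_mul hx0.le hx1.le
  have hnorm : ‖ZMod.stdAddChar a - 1‖ = 2 * Real.sin (Real.pi * x) := by
    have : (ZMod.stdAddChar a : ℂ) = Complex.exp (Complex.I * (2 * Real.pi * x : ℝ)) := by
      have h := ZMod.stdAddChar_coe (N := p) (a.val : ℤ)
      rw [Int.cast_natCast, ZMod.natCast_zmod_val] at h
      rw [h, hx]; push_cast; congr 1; ring
    rw [this, Complex.norm_exp_I_mul_ofReal_sub_one, Real.norm_eq_abs, abs_of_nonneg]
    · congr 2; ring
    · rw [show 2 * Real.pi * x / 2 = Real.pi * x by ring]; linarith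
  rw [hnorm]
  calc 2 / (2 * Real.sin (Real.pi * x)) ≤ 2 / (2 * (2 * min x (1 - x))) := by gcongr
    _ ≤ 1 / 2 * (1 / x + 1 / (1 - x)) := by
      have h1 : 0 < 1 / x := by positivity
      have h2 : 0 < 1 / (1 - x) := one_div_pos.2 (by linarith)
      rcases min_choice x (1 - x) with h | h <;> rw [h]
      · have : 2 / (2 * (2 * x)) = 1 / 2 * (1 / x) := by field_simp
        linarith
      · have h3 : 1 - x ≠ 0 := by linarith
        have : 2 / (2 * (2 * (1 - x))) = 1 / 2 * (1 / (1 - x)) := by field_simp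
        linarith
    _ = _ := by
      have h3 : (p : ℝ) - a.val ≠ 0 := by linarith
      have h4 : 1 - x = (p - a.val) / p := by rw [hx]; field_simp
      rw [h4, hx]; field_simp

theorem ZMod.sum_two_div_norm_stdAddChar_sub_one_le (p : ℕ) [NeZero p] :
    ∑ a ∈ (univ : Finset (ZMod p)).erase 0, 2 / ‖ZMod.stdAddChar a - 1‖ ≤
      p * (1 + Real.log p) := by
  have hp : 0 < p := NeZero.pos p
  have hH : ∑ k ∈ range (p - 1), (1 : ℝ) / (k + 1 : ℕ) ≤ 1 + Real.log p := by
    have h := harmonic_le_one_add_log (p - 1)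
    simp only [harmonic] at h
    push_cast at h ⊢
    simp only [one_div]
    refine h.trans ?_
    rcases Nat.eq_zero_or_pos (p - 1) with h0 | h0
    · simp [h0, Real.log_natCast_nonneg]
    · gcongr
      exact Nat.sub_le _ _
  calc ∑ a ∈ (univ : Finset (ZMod p)).erase 0, 2 / ‖ZMod.stdAddChar a - 1‖
      ≤ ∑ a ∈ (univ : Finset (ZMod p)).erase 0,
          (p : ℝ) / 2 * (1 / (a.val : ℝ) + 1 / ((p : ℝ) - a.val)) :=
        sum_le_sum fun a ha => two_div_norm_stdAddChar_sub_one_le (ne_of_mem_erase ha)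
    _ = ∑ k ∈ range (p - 1), (p : ℝ) / 2 * (1 / (k + 1 : ℕ) + 1 / ((p : ℝ) - (k + 1 : ℕ))) := by
      refine sum_bij' (fun a _ => a.val - 1) (fun k _ => ((k + 1 : ℕ) : ZMod p)) ?_ ?_ ?_ ?_ ?_
      · intro a ha
        have := ZMod.val_lt a
        have := (ZMod.val_ne_zero a).2 (ne_of_mem_erase ha)
        rw [mem_range]; omega
      · intro k hk
        rw [mem_range] at hk
        refine mem_erase.2 ⟨fun h => ?_, mem_univ _⟩
        rw [ZMod.natCast_eq_zero_iff] at h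
        have := Nat.le_of_dvd (by omega) h
        omega
      · intro a ha
        have := (ZMod.val_ne_zero a).2 (ne_of_mem_erase ha)
        rw [Nat.sub_add_cancel (by omega), ZMod.natCast_zmod_val]
      · intro k hk
        rw [mem_range] at hk
        rw [ZMod.val_natCast, Nat.mod_eq_of_lt (by omega)]; omega
      · intro a ha
        have := (ZMod.val_ne_zero a).2 (ne_of_mem_erase ha)
        rw [Nat.sub_add_cancel (by omega)]
    _ = (p : ℝ) / 2 * (∑ k ∈ range (p - 1), (1 : ℝ) / (k + 1 : ℕ) +
          ∑ k ∈ range (p - 1), (1 : ℝ) / (k + 1 : ℕ)) := by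
      rw [← mul_sum, sum_add_distrib]
      congr 2
      rw [← sum_range_reflect]
      refine sum_congr rfl fun k hk => ?_
      rw [mem_range] at hk
      have : ((p - 1 - 1 - k + 1 : ℕ) : ℝ) = p - (k + 1 : ℕ) := by
        rw [← Nat.cast_sub (by omega)]; congr 1; omega
      rw [this]; ring_nf
    _ ≤ (p : ℝ) / 2 * ((1 + Real.log p) + (1 + Real.log p)) := by gcongr
    _ = p * (1 + Real.log p) := by ring

theorem norm_gaussSum_stdAddChar {p : ℕ} [Fact p.Prime] {χ : MulChar (ZMod p) ℂ} (hχ : χ ≠ 1) :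
    ‖gaussSum χ ZMod.stdAddChar‖ = Real.sqrt p := by
  have h := gaussSum_mul_gaussSum_eq_card hχ (ZMod.isPrimitive_stdAddChar p)
  rw [← star_gaussSum_eq, ZMod.card] at h
  have h' := congrArg norm h
  rw [norm_mul, norm_star, Complex.norm_natCast] at h'
  rw [← h', Real.sqrt_mul_self (norm_nonneg _)]

/-- The **Pólya–Vinogradov inequality** for a nontrivial character to a prime modulus. -/
theorem MulChar.norm_sum_range_le {p : ℕ} [Fact p.Prime] {χ : MulChar (ZMod p) ℂ} (hχ : χ ≠ 1)
    (M : ZMod p) (N : ℕ) :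
    ‖∑ i ∈ range N, χ (M + i)‖ ≤ Real.sqrt p * (1 + Real.log p) := by
  have hp : 0 < (p : ℝ) := by exact_mod_cast NeZero.pos p
  set ψ : AddChar (ZMod p) ℂ := ZMod.stdAddChar with hψ
  have hχ' : χ⁻¹ ≠ 1 := inv_ne_one.2 hχ
  have key (m : ZMod p) : χ m * gaussSum χ⁻¹ ψ = ∑ a, χ⁻¹ a * ψ (a * m) := by
    rcases eq_or_ne m 0 with rfl | hm
    · simp [MulChar.sum_eq_zero_of_ne_one hχ']
    · obtain ⟨u, rfl⟩ := hm.isUnit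
      have h := gaussSum_mulShift χ⁻¹ ψ u
      rw [← h, ← mul_assoc, ← MulChar.mul_apply, mul_inv_cancel, MulChar.one_apply_coe, one_mul]
      simp [gaussSum, AddChar.mulShift_apply, mul_comm]
  have hsum : (∑ i ∈ range N, χ (M + i)) * gaussSum χ⁻¹ ψ =
      ∑ a ∈ (univ : Finset (ZMod p)).erase 0, χ⁻¹ a * ψ (a * M) * ∑ i ∈ range N, ψ a ^ i := by
    simp_rw [sum_mul, key]
    rw [sum_comm, ← sum_erase (a := 0) _ (by simp)]
    refine sum_congr rfl fun a _ => ?_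
    rw [mul_sum]
    refine sum_congr rfl fun i _ => ?_
    rw [mul_add, AddChar.map_add_eq_mul, mul_comm a (i : ZMod p), ← nsmul_eq_mul,
      AddChar.map_nsmul_eq_pow, mul_assoc]
  have hψn (a : ZMod p) : ‖ψ a‖ = 1 := AddChar.norm_apply _ _
  have hbound : ‖∑ i ∈ range N, χ (M + i)‖ * Real.sqrt p ≤ p * (1 + Real.log p) := by
    rw [← norm_gaussSum_stdAddChar hχ', ← norm_mul, ← hψ, hsum]
    refine (norm_sum_le _ _).trans
      (le_trans (sum_le_sum fun a ha => ?_) (ZMod.sum_two_div_norm_stdAddChar_sub_one_le p))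
    have ha0 := ne_of_mem_erase ha
    rw [norm_mul, norm_mul, hψn, mul_one]
    have h1 : ψ a ≠ 1 := fun h => ha0 (((ZMod.isPrimitive_stdAddChar p).zmod_char_eq_one_iff p a).1 h)
    calc _ ≤ 1 * (2 / ‖ψ a - 1‖) := by
          gcongr
          · exact DirichletCharacter.norm_le_one _ _
          · exact norm_geom_sum_le (hψn a) h1 N
      _ = _ := one_mul _
  refine le_of_mul_le_mul_right (hbound.trans_eq ?_) (Real.sqrt_pos.2 hp)
  rw [mul_right_comm, Real.mul_self_sqrt hp.le]

theorem abs_sum_range_quadraticChar_le {p : ℕ} [Fact p.Prime] (hp : p ≠ 2) (M : ZMod p) (N : ℕ) :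
    |∑ i ∈ range N, (quadraticChar (ZMod p) (M + i) : ℝ)| ≤ Real.sqrt p * (1 + Real.log p) := by
  have hχ : (quadraticChar (ZMod p)).ringHomComp (Int.castRingHom ℂ) ≠ 1 :=
    (MulChar.ringHomComp_ne_one_iff (RingHom.injective_int _)).2
      (quadraticChar_ne_one (by rwa [ZMod.ringChar_zmod_n]))
  have h := MulChar.norm_sum_range_le hχ M N
  simp only [MulChar.ringHomComp_apply, eq_intCast] at h
  rw [← Real.norm_eq_abs, ← Complex.norm_real]
  push_cast
  exact h

open Classical in
theorem qrMeasure_toReal (p : ℕ) (s : Set UnitAddCircle) :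
    (qrMeasure p s).toReal =
      (#{n ∈ Icc 1 p | ((((n : ℕ) : ℝ) ^ 2 / (p : ℝ) : ℝ) : UnitAddCircle) ∈ s} : ℝ) / p := by
  rw [qrMeasure, Measure.smul_apply, Measure.finsetSum_apply, smul_eq_mul, ENNReal.toReal_mul]
  simp only [Measure.dirac_apply, Set.indicator_apply, Pi.one_apply, sum_boole]
  rw [ENNReal.toReal_inv, ENNReal.toReal_natCast, ENNReal.toReal_natCast, div_eq_inv_mul]

theorem coe_div_mem_image_Ico_iff {p : ℕ} (hp : 0 < p) (a b : ℝ) (m : ℤ) :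
    (((m : ℝ) / p : ℝ) : UnitAddCircle) ∈ (fun x : ℝ => (x : UnitAddCircle)) '' Set.Ico a b ↔
      ∃ i ∈ range (⌈p * b⌉ - ⌈p * a⌉).toNat, (m : ZMod p) = (⌈p * a⌉ : ZMod p) + i := by
  have hp' : (0 : ℝ) < p := by exact_mod_cast hp
  constructor
  · rintro ⟨x, ⟨hax, hxb⟩, hx⟩
    have hx' : ((x - m / p : ℝ) : UnitAddCircle) = 0 := by
      rw [AddCircle.coe_sub, sub_eq_zero]; exact hx
    obtain ⟨k, hk⟩ := (AddCircle.coe_eq_zero_iff (1 : ℝ)).1 hx'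
    rw [zsmul_eq_mul, mul_one] at hk
    have hpx : p * x = ((m + k * p : ℤ) : ℝ) := by
      push_cast
      rw [show x = m / p + k by linarith]; field_simp
    have h1 : ⌈p * a⌉ ≤ m + k * p := by
      rw [Int.ceil_le, ← hpx]; gcongr
    have h2 : m + k * p < ⌈p * b⌉ := by
      rw [Int.lt_ceil, ← hpx]; gcongr
    refine ⟨(m + k * p - ⌈p * a⌉).toNat, by rw [mem_range]; omega, ?_⟩
    have h3 : (((m + k * p - ⌈p * a⌉).toNat : ℤ) : ZMod p) = ((m + k * p - ⌈p * a⌉ : ℤ) : ZMod p) := by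
      rw [Int.toNat_of_nonneg (by omega)]
    rw [Int.cast_natCast] at h3
    rw [h3]; push_cast; simp
  · rintro ⟨i, hi, h⟩
    rw [mem_range] at hi
    have h' : ((m : ℤ) : ZMod p) = ((⌈p * a⌉ + i : ℤ) : ZMod p) := by rw [h]; push_cast; rfl
    obtain ⟨k, hk⟩ := (ZMod.intCast_eq_intCast_iff_dvd_sub _ _ _).1 h'
    refine ⟨((⌈p * a⌉ + i : ℤ) : ℝ) / p, ⟨?_, ?_⟩, ?_⟩
    · rw [le_div_iff₀ hp', mul_comm, ← Int.ceil_le]; omega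
    · rw [div_lt_iff₀ hp', mul_comm b, ← Int.lt_ceil]; omega
    · rw [show (⌈p * a⌉ + i : ℤ) = m + p * k by linarith]
      dsimp only
      rw [← sub_eq_zero, ← AddCircle.coe_sub, AddCircle.coe_eq_zero_iff]
      refine ⟨k, ?_⟩
      push_cast
      rw [zsmul_eq_mul, mul_one]; field_simp; ring

theorem card_sq_mem_eq_sum_quadraticChar {p : ℕ} [Fact p.Prime] (hp : p ≠ 2) (M : ZMod p) {N : ℕ}
    (hN : N ≤ p) :
    (#{n ∈ Icc 1 p | ∃ i ∈ range N, ((n : ℕ) : ZMod p) ^ 2 = M + i} : ℝ) =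
      N + ∑ i ∈ range N, (quadraticChar (ZMod p) (M + i) : ℝ) := by
  have hp0 := NeZero.pos p
  have h1 : #{n ∈ Icc 1 p | ∃ i ∈ range N, ((n : ℕ) : ZMod p) ^ 2 = M + i} =
      #{x : ZMod p | ∃ i ∈ range N, x ^ 2 = M + i} := by
    refine card_bij (fun n _ => (n : ZMod p)) ?_ ?_ ?_
    · intro n hn
      simpa using (mem_filter.1 hn).2
    · intro n hn n' hn' h
      have h1 := mem_Icc.1 (mem_filter.1 hn).1
      have h2 := mem_Icc.1 (mem_filter.1 hn').1
      rw [ZMod.natCast_eq_natCast_iff, Nat.modEq_iff_dvd] at h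
      obtain ⟨k, hk⟩ := h
      have hk1 : k < 1 := by by_contra! hc; nlinarith
      have hk2 : -1 < k := by by_contra! hc; nlinarith
      obtain rfl : k = 0 := by omega
      omega
    · intro x hx
      rcases eq_or_ne x 0 with rfl | h0
      · refine ⟨p, mem_filter.2 ⟨mem_Icc.2 ⟨hp0, le_rfl⟩, ?_⟩, by simp⟩
        simpa using hx
      · have := (ZMod.val_ne_zero x).2 h0
        refine ⟨x.val, mem_filter.2 ⟨mem_Icc.2 ⟨by omega, (ZMod.val_lt x).le⟩, ?_⟩, by simp⟩
        simpa using hx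
  have h2 : ({x : ZMod p | ∃ i ∈ range N, x ^ 2 = M + i} : Finset (ZMod p)) =
      (range N).biUnion fun i => {x : ZMod p | x ^ 2 = M + i} := by
    ext x; simp
  rw [h1, h2, card_biUnion]
  · have h3 (i : ℕ) : ((#{x : ZMod p | x ^ 2 = M + i} : ℕ) : ℝ) =
        quadraticChar (ZMod p) (M + i) + 1 := by
      have h := quadraticChar_card_sqrts (F := ZMod p) (by rwa [ZMod.ringChar_zmod_n]) (M + i)
      rw [Set.toFinset_ofPred] at h
      exact_mod_cast h
    push_cast
    simp only [h3, sum_add_distrib, sum_const, card_range, nsmul_eq_mul, mul_one]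
    ring
  · intro i hi j hj hij
    rw [Function.onFun, disjoint_left]
    intro x hx hx'
    simp only [mem_filter, mem_univ, true_and] at hx hx'
    have h : (i : ZMod p) = j := add_left_cancel (hx.symm.trans hx')
    rw [ZMod.natCast_eq_natCast_iff] at h
    simp only [coe_range, Set.mem_Iio] at hi hj
    exact hij (h.eq_of_lt_of_lt (by omega) (by omega))

theorem abs_qrMeasure_arc_sub_le {p : ℕ} [Fact p.Prime] (hp : p ≠ 2) {a b : ℝ} (hab : a ≤ b)
    (hba : b ≤ a + 1) :
    |(qrMeasure p ((fun x : ℝ => (x : UnitAddCircle)) '' Set.Ico a b)).toReal - (b - a)| ≤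
      (1 + Real.sqrt p * (1 + Real.log p)) / p := by
  classical
  have hp0 := NeZero.pos p
  have hp' : (0 : ℝ) < p := by exact_mod_cast hp0
  set N := (⌈p * b⌉ - ⌈p * a⌉).toNat with hNdef
  have hle : ⌈p * a⌉ ≤ ⌈p * b⌉ := Int.ceil_mono (by gcongr)
  have hle' : ⌈p * b⌉ ≤ ⌈p * a⌉ + p := by
    rw [← Int.ceil_add_natCast]
    exact Int.ceil_mono (by nlinarith)
  have hNZ : (N : ℤ) = ⌈p * b⌉ - ⌈p * a⌉ := Int.toNat_of_nonneg (by omega)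
  have hN : N ≤ p := by omega
  have hNR : (N : ℝ) = ⌈p * b⌉ - ⌈p * a⌉ := by exact_mod_cast hNZ
  have hNabs : |(N : ℝ) - p * (b - a)| ≤ 1 := by
    have := Int.le_ceil (p * a); have := Int.ceil_lt_add_one (p * a)
    have := Int.le_ceil (p * b); have := Int.ceil_lt_add_one (p * b)
    rw [hNR, abs_le]; constructor <;> linarith
  have hfilter : #{n ∈ Icc 1 p | ((((n : ℕ) : ℝ) ^ 2 / (p : ℝ) : ℝ) : UnitAddCircle) ∈
        (fun x : ℝ => (x : UnitAddCircle)) '' Set.Ico a b} =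
      #{n ∈ Icc 1 p | ∃ i ∈ range N, ((n : ℕ) : ZMod p) ^ 2 = (⌈p * a⌉ : ZMod p) + i} := by
    congr 1
    refine filter_congr fun n _ => ?_
    have h := coe_div_mem_image_Ico_iff hp0 a b ((n : ℤ) ^ 2)
    push_cast at h
    exact h
  have hχ := abs_sum_range_quadraticChar_le hp (⌈p * a⌉ : ZMod p) N
  rw [qrMeasure_toReal, hfilter, card_sq_mem_eq_sum_quadraticChar hp _ hN, le_div_iff₀ hp',
    ← abs_of_pos hp', ← abs_mul, abs_of_pos hp']
  set S := ∑ i ∈ range N, (quadraticChar (ZMod p) ((⌈p * a⌉ : ZMod p) + i) : ℝ)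
  rw [show ((N + S) / p - (b - a)) * p = (N - p * (b - a)) + S by field_simp; ring]
  exact (abs_add_le _ _).trans (add_le_add hNabs hχ)

end QuadraticResidues

/-- Pólya–Vinogradov-type bound: for every odd prime `p`, the discrepancy of the
distribution of quadratic residues satisfies `D(μ_p) ≤ C (log p)/√p`. -/
theorem stmt9 : ∃ C : ℝ, 0 < C ∧
    ∀ p : ℕ, p.Prime → Odd p →
      discrepancy (qrMeasure p) ≤ C * Real.log p / Real.sqrt p := by
  refine ⟨3, by norm_num, fun p hp hodd => ?_⟩
  have : Fact p.Prime := ⟨hp⟩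
  have hne : p ≠ 2 := by rintro rfl; exact absurd hodd (by decide)
  refine Real.sSup_le ?_ (by have := Real.log_natCast_nonneg p; positivity)
  rintro d ⟨a, b, hab, hba, rfl⟩
  refine (abs_qrMeasure_arc_sub_le hne hab hba).trans ?_
  have h3 : 3 ≤ p := by
    have := hp.two_le
    rcases hodd with ⟨k, rfl⟩; omega
  have h3' : (3 : ℝ) ≤ p := by exact_mod_cast h3
  have hp' : (0 : ℝ) < p := by linarith
  have hlog : 1 ≤ Real.log p := by
    rw [Real.le_log_iff_exp_le hp']
    linarith [Real.exp_one_lt_d9]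
  have hs : 1 ≤ Real.sqrt p := Real.one_le_sqrt.2 (by linarith)
  have hss : Real.sqrt p * Real.sqrt p = p := Real.mul_self_sqrt hp'.le
  rw [div_le_div_iff₀ hp' (by linarith)]
  have h1 : (p : ℝ) ≤ Real.log p * p := le_mul_of_one_le_left hp'.le hlog
  have h2 : Real.sqrt p ≤ p := by nlinarith
  calc (1 + Real.sqrt p * (1 + Real.log p)) * Real.sqrt p
      = Real.sqrt p + (Real.sqrt p * Real.sqrt p) * (1 + Real.log p) := by ring
    _ = Real.sqrt p + p * (1 + Real.log p) := by rw [hss]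
    _ ≤ 3 * Real.log p * p := by linarith
end

section
/- Let f : 𝕋 → ℝ be continuous with f ≥ 0, not identically 0, and mean value f̄ = ∫_𝕋 f(x) dx. Then for every ε > 0 there exists a Borel measurable map T : 𝕋 → 𝕋 such that the pushforward of the measure f dx under T equals the uniform measure f̄ dx, and ∫_𝕋 |T(x) − x| f(x) dx ≤ W₁(f dx, f̄ dx) + ε. -/
open MeasureTheory
open scoped ENNReal

open ProbabilityTheory in
lemma continuous_cdf (μ : Measure ℝ) [IsProbabilityMeasure μ] [NullSingletonClass μ] :
    Continuous (cdf μ) := by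
  refine continuous_iff_continuousAt.2 fun a => ?_
  have hmono := monotone_cdf μ
  rw [hmono.continuousAt_iff_leftLim_eq_rightLim, StieltjesFunction.rightLim_eq]
  refine le_antisymm (hmono.leftLim_le le_rfl) ?_
  have h := (cdf μ).measure_singleton a
  rw [measure_cdf, measure_singleton] at h
  simpa using h.symm

open ProbabilityTheory in
/-- The cumulative distribution function of an atomless probability measure on `ℝ` pushes it
forward to the uniform measure. -/
lemma exists_measurable_map_real_eq_volume_unitInterval (μ : Measure ℝ) [IsProbabilityMeasure μ]
    [NullSingletonClass μ] : ∃ F : ℝ → unitInterval, Measurable F ∧ μ.map F = volume := by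
  have hc := continuous_cdf μ
  have hmono := monotone_cdf μ
  obtain ⟨F, hF⟩ : ∃ F : ℝ → unitInterval, ∀ x, (F x : ℝ) = cdf μ x :=
    ⟨fun x => ⟨cdf μ x, cdf_nonneg μ x, cdf_le_one μ x⟩, fun _ => rfl⟩
  have hFm : Measurable F := by
    refine (MeasurableEmbedding.subtype_coe measurableSet_Icc).measurable_comp_iff.1 ?_
    exact (funext hF : Subtype.val ∘ F = cdf μ) ▸ hc.measurable
  have hmem : ∀ (t : unitInterval) x, x ∈ F ⁻¹' Set.Iic t ↔ cdf μ x ≤ t := fun t x => by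
    rw [← hF]; rfl
  have hsurj : ∀ t, 0 < t → t < 1 → ∃ x, cdf μ x = t := fun t h0 h1 =>
    mem_range_of_exists_le_of_exists_ge hc
      (((tendsto_cdf_atBot μ).eventually_le_const h0).exists)
      (((tendsto_cdf_atTop μ).eventually_const_le h1).exists)
  have : IsProbabilityMeasure (μ.map F) := Measure.isProbabilityMeasure_map hFm.aemeasurable
  refine ⟨F, hFm, Measure.ext_of_Iic _ _ fun t => ?_⟩
  rw [Measure.map_apply hFm measurableSet_Iic, unitInterval.volume_Iic]
  apply le_antisymm
  · refine ENNReal.le_of_forall_pos_le_add fun δ hδ _ => ?_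
    have hδ' : (0 : ℝ) < δ := hδ
    rw [← ENNReal.ofReal_coe_nnreal, ← ENNReal.ofReal_add t.2.1 δ.coe_nonneg]
    rcases lt_or_ge ((t : ℝ) + δ) 1 with h | h
    · obtain ⟨x, hx⟩ := hsurj (t + δ) (by linarith [t.2.1]) h
      rw [← hx, ofReal_cdf]
      refine measure_mono fun y hy => ?_
      rw [hmem] at hy
      by_contra hxy
      have := hmono (le_of_not_ge hxy)
      linarith
    · exact prob_le_one.trans (by simpa using h)
  · rcases t.2.1.eq_or_lt with h0 | h0
    · simp [← h0]
    rcases t.2.2.eq_or_lt with h1 | h1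
    · rw [h1, ENNReal.ofReal_one, ← measure_univ (μ := μ)]
      exact measure_mono fun x _ => (hmem t x).2 (h1 ▸ cdf_le_one μ x)
    obtain ⟨x, hx⟩ := hsurj t h0 h1
    rw [← hx, ofReal_cdf]
    exact measure_mono fun y hy => (hmem t y).2 (hx ▸ hmono hy)

/-- Any finite measure on a standard Borel space is the image of any atomless finite measure of
the same mass. -/
lemma exists_measurable_map_eq_of_nullSingletonClass {X Y : Type*} [MeasurableSpace X]
    [StandardBorelSpace X] [MeasurableSpace Y] [StandardBorelSpace Y] [Nonempty Y]
    (μ : Measure X) [IsFiniteMeasure μ] [NullSingletonClass μ] (ν : Measure Y)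
    (h : μ Set.univ = ν Set.univ) : ∃ T : X → Y, Measurable T ∧ μ.map T = ν := by
  rcases eq_or_ne μ 0 with rfl | hμ
  · have hν : ν = 0 := Measure.measure_univ_eq_zero.1 (by simpa using h.symm)
    exact ⟨fun _ => Classical.arbitrary Y, measurable_const, by simp [hν]⟩
  have hm0 : μ Set.univ ≠ 0 := by simpa using hμ
  have hm : μ Set.univ ≠ ∞ := measure_ne_top μ _
  have hμ1 : IsProbabilityMeasure ((μ Set.univ)⁻¹ • μ) :=
    ⟨by simp [ENNReal.inv_mul_cancel hm0 hm]⟩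
  have hν1 : IsProbabilityMeasure ((μ Set.univ)⁻¹ • ν) :=
    ⟨by simp [← h, ENNReal.inv_mul_cancel hm0 hm]⟩
  set e := embeddingReal X
  have he : MeasurableEmbedding e := measurableEmbedding_embeddingReal X
  have : IsProbabilityMeasure (((μ Set.univ)⁻¹ • μ).map e) :=
    Measure.isProbabilityMeasure_map he.measurable.aemeasurable
  have : NullSingletonClass (((μ Set.univ)⁻¹ • μ).map e) := ⟨fun x => by
    rw [Measure.map_apply he.measurable (measurableSet_singleton x), Measure.smul_apply,
      (Set.subsingleton_singleton.preimage he.injective).measure_zero, smul_zero]⟩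
  obtain ⟨F, hF, hFμ⟩ := exists_measurable_map_real_eq_volume_unitInterval
    (((μ Set.univ)⁻¹ • μ).map e)
  obtain ⟨g, hg, hgν⟩ := Measure.exists_measurable_map_eq ((μ Set.univ)⁻¹ • ν)
  refine ⟨g ∘ F ∘ e, hg.comp (hF.comp he.measurable), ?_⟩
  rw [← hFμ, Measure.map_map hF he.measurable, Measure.map_map hg (hF.comp he.measurable),
    Measure.map_smul] at hgν
  have := congrArg (μ Set.univ • ·) hgν
  simpa [smul_smul, ENNReal.mul_inv_cancel hm0 hm] using this

lemma measure_eq_tsum_restrict_preimage_singleton {α ι : Type*} [MeasurableSpace α] [Countable ι]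
    [MeasurableSpace ι] [MeasurableSingletonClass ι] (ρ : Measure α) {g : α → ι}
    (hg : Measurable g) {A : Set α} (hA : MeasurableSet A) :
    ρ A = ∑' i, ρ.restrict (g ⁻¹' {i}) A := by
  rw [← Measure.restrict_iUnion_apply
    (fun i j hij => Disjoint.preimage g (Set.disjoint_singleton.2 hij))
    (fun i => hg (measurableSet_singleton i)) hA]
  have : ⋃ i, g ⁻¹' {i} = Set.univ := by ext; simp
  rw [this, Measure.restrict_univ]

/-- A coupling with atomless first marginal can be replaced by one induced by a map, without
changing the joint law of a countable discretization of the first variable and the second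
variable. -/
lemma exists_measurable_map_prodMk_eq {X Y : Type*} [MeasurableSpace X]
    [StandardBorelSpace X] [MeasurableSpace Y] [StandardBorelSpace Y] [Nonempty Y]
    (γ : Measure (X × Y)) [IsFiniteMeasure γ] [NullSingletonClass (γ.map Prod.fst)]
    {k : X → ℕ} (hk : Measurable k) :
    ∃ T : X → Y, Measurable T ∧
      (γ.map Prod.fst).map (fun x => (k x, T x)) = γ.map (fun z => (k z.1, z.2)) := by
  have key : ∀ n, ∃ T : X → Y, Measurable T ∧ ((γ.map Prod.fst).restrict (k ⁻¹' {n})).map T =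
      (γ.restrict (Prod.fst ⁻¹' (k ⁻¹' {n}))).map Prod.snd := fun n => by
    apply exists_measurable_map_eq_of_nullSingletonClass
    have hn : MeasurableSet (k ⁻¹' {n}) := hk (measurableSet_singleton n)
    rw [Measure.map_apply measurable_snd .univ, Set.preimage_univ,
      Measure.restrict_apply_univ, Measure.restrict_apply_univ, Measure.map_apply measurable_fst hn]
  choose T hT hTn using key
  have hTk : Measurable fun x => T (k x) x :=
    (measurable_from_prod_countable_right (f := fun p : ℕ × X => T p.1 p.2) hT).comp
      (hk.prodMk measurable_id)
  refine ⟨fun x => T (k x) x, hTk, Measure.ext fun S hS => ?_⟩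
  have hkT : Measurable fun x => (k x, T (k x) x) := hk.prodMk hTk
  have hkz : Measurable fun z : X × Y => (k z.1, z.2) :=
    (hk.comp measurable_fst).prodMk measurable_snd
  have hSn : ∀ n, MeasurableSet (Prod.mk n ⁻¹' S) := fun n => measurable_prodMk_left hS
  rw [Measure.map_apply hkT hS, Measure.map_apply hkz hS,
    measure_eq_tsum_restrict_preimage_singleton _ hk (hkT hS),
    measure_eq_tsum_restrict_preimage_singleton _ (hk.comp measurable_fst) (hkz hS)]
  refine tsum_congr fun n => ?_
  have hn := DFunLike.congr_fun (hTn n) (Prod.mk n ⁻¹' S)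
  rw [Measure.map_apply (hT n) (hSn n), Measure.map_apply measurable_snd (hSn n),
    Measure.restrict_apply (hT n (hSn n)), Measure.restrict_apply (measurable_snd (hSn n))] at hn
  rw [Measure.restrict_apply (hkT hS), Measure.restrict_apply (hkz hS)]
  convert hn using 2
  · ext x
    simp +contextual [and_congr_left_iff]
  · ext z
    simp +contextual [and_congr_left_iff]

lemma exists_measurable_nat_dist_lt {X : Type*} [PseudoMetricSpace X]
    [TopologicalSpace.SeparableSpace X] [Nonempty X] [MeasurableSpace X] [OpensMeasurableSpace X]
    {δ : ℝ} (hδ : 0 < δ) :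
    ∃ (c : ℕ → X) (k : X → ℕ), Measurable k ∧ ∀ x, dist x (c (k x)) < δ := by
  classical
  have hex : ∀ x, ∃ n, dist x (TopologicalSpace.denseSeq X n) < δ := fun x =>
    (TopologicalSpace.denseRange_denseSeq X).exists_dist_lt x hδ
  exact ⟨TopologicalSpace.denseSeq X, fun x => Nat.find (hex x),
    measurable_find hex fun n => measurableSet_lt (measurable_id.dist measurable_const)
      measurable_const, fun x => Nat.find_spec (hex x)⟩

/-- On a compact metric space, the cost of a coupling with atomless first marginal is approached
by transport maps. -/
lemma exists_measurable_map_integral_dist_le {X : Type*} [MetricSpace X] [CompactSpace X]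
    [Nonempty X] [MeasurableSpace X] [BorelSpace X] (γ : Measure (X × X)) [IsFiniteMeasure γ]
    [NullSingletonClass (γ.map Prod.fst)] {ε : ℝ} (hε : 0 < ε) :
    ∃ T : X → X, Measurable T ∧ (γ.map Prod.fst).map T = γ.map Prod.snd ∧
      ∫ x, dist (T x) x ∂(γ.map Prod.fst) ≤ ∫ z, dist z.1 z.2 ∂γ + ε := by
  set M := γ.real Set.univ
  have hM : 0 ≤ M := measureReal_nonneg
  set δ := ε / (2 * (M + 1))
  have hδ : 0 < δ := by positivity
  have hδM : 2 * (δ * M) ≤ ε := by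
    have : δ * (2 * (M + 1)) = ε := div_mul_cancel₀ _ (by positivity)
    nlinarith
  obtain ⟨c, k, hk, hck⟩ := exists_measurable_nat_dist_lt (X := X) hδ
  obtain ⟨T, hT, hTγ⟩ := exists_measurable_map_prodMk_eq γ hk
  have hkT : Measurable fun x => (k x, T x) := hk.prodMk hT
  have hkz : Measurable fun z : X × X => (k z.1, z.2) :=
    (hk.comp measurable_fst).prodMk measurable_snd
  have hint : ∀ {Ω : Type _} [MeasurableSpace Ω] (ρ : Measure Ω) [IsFiniteMeasure ρ]
      (a b : Ω → X), Measurable a → Measurable b → Integrable (fun ω => dist (a ω) (b ω)) ρ :=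
    fun ρ _ a b ha hb => Integrable.of_bound (ha.dist hb).aestronglyMeasurable
      (Metric.diam (Set.univ : Set X)) (.of_forall fun ω => by
        rw [Real.norm_of_nonneg dist_nonneg]
        exact Metric.dist_le_diam_of_mem isCompact_univ.isBounded trivial trivial)
  have hc : Measurable fun n => c n := measurable_from_nat
  have hD : Measurable fun p : ℕ × X => dist p.2 (c p.1) :=
    measurable_snd.dist (hc.comp measurable_fst)
  have hmass : (γ.map Prod.fst).real Set.univ = M := by
    rw [map_measureReal_apply measurable_fst .univ, Set.preimage_univ]
  refine ⟨T, hT, ?_, ?_⟩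
  · have := congrArg (Measure.map Prod.snd) hTγ
    rwa [Measure.map_map measurable_snd hkT, Measure.map_map measurable_snd hkz] at this
  have heq : ∫ x, dist (T x) (c (k x)) ∂(γ.map Prod.fst) = ∫ z, dist z.2 (c (k z.1)) ∂γ := by
    have := congrArg (fun ρ => ∫ p : ℕ × X, dist p.2 (c p.1) ∂ρ) hTγ
    simpa only [integral_map hkT.aemeasurable hD.aestronglyMeasurable,
      integral_map hkz.aemeasurable hD.aestronglyMeasurable] using this
  have h1 : ∫ x, dist (T x) x ∂(γ.map Prod.fst) ≤
      ∫ x, dist (T x) (c (k x)) ∂(γ.map Prod.fst) + δ * M := by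
    have hi := hint (γ.map Prod.fst) T (fun x => c (k x)) hT (hc.comp hk)
    calc _ ≤ ∫ x, (dist (T x) (c (k x)) + δ) ∂(γ.map Prod.fst) := by
          refine integral_mono (hint _ _ _ hT measurable_id) (hi.add (integrable_const δ))
            fun x => ?_
          have := dist_triangle_right (T x) x (c (k x))
          have := hck x
          simp only
          linarith
      _ = _ := by
          rw [integral_add hi (integrable_const δ), integral_const, hmass, smul_eq_mul, mul_comm M]
  have h2 : ∫ z, dist z.2 (c (k z.1)) ∂γ ≤ ∫ z, dist z.1 z.2 ∂γ + δ * M := by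
    have hi := hint γ _ _ measurable_fst measurable_snd
    calc _ ≤ ∫ z, (dist z.1 z.2 + δ) ∂γ := by
          refine integral_mono (hint _ _ _ measurable_snd (hc.comp (hk.comp measurable_fst)))
            (hi.add (integrable_const δ)) fun z => ?_
          have := dist_triangle_left z.2 (c (k z.1)) z.1
          have := hck z.1
          simp only
          linarith
      _ = _ := by
          rw [integral_add hi (integrable_const δ), integral_const, smul_eq_mul, mul_comm δ]
  linarith

/-- Near-optimal transport maps exist: for continuous `f ≥ 0` on `𝕋`, not identically
`0`, with mean `f̄`, and every `ε > 0`, there is a measurable `T : 𝕋 → 𝕋` pushing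
`f dx` forward to `f̄ dx` with `∫ |T(x) - x| f(x) dx ≤ W₁(f dx, f̄ dx) + ε`. -/
theorem stmt13 (f : UnitAddCircle → ℝ) (hf : Continuous f) (hpos : ∀ x, 0 ≤ f x)
    (hne : ∃ x, f x ≠ 0) (ε : ℝ) (hε : 0 < ε) :
    ∃ T : UnitAddCircle → UnitAddCircle, Measurable T ∧
      (volume.withDensity fun x => ENNReal.ofReal (f x)).map T =
        volume.withDensity (fun _ => ENNReal.ofReal (∫ x, f x)) ∧
      ∫ x, dist (T x) x * f x ≤
        Wdist 1 (volume.withDensity fun x => ENNReal.ofReal (f x))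
          (volume.withDensity fun _ => ENNReal.ofReal (∫ x, f x)) + ε := by
  have hvol : NullSingletonClass (volume : Measure UnitAddCircle) := ⟨fun x => by
    simpa using AddCircle.volume_closedBall 1 (x := x) 0⟩
  have hfi : Integrable f := hf.integrable_of_hasCompactSupport (HasCompactSupport.of_compactSpace f)
  have hfm : Measurable fun x => ENNReal.ofReal (f x) := hf.measurable.ennreal_ofReal
  set μ := (volume : Measure UnitAddCircle).withDensity fun x => ENNReal.ofReal (f x) with hμ
  set ν := (volume : Measure UnitAddCircle).withDensity fun _ => ENNReal.ofReal (∫ x, f x) with hν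
  have : IsFiniteMeasure μ := isFiniteMeasure_withDensity_ofReal hfi.2
  have hmass : μ Set.univ = ν Set.univ := by
    rw [hμ, hν, withDensity_apply _ .univ, withDensity_apply _ .univ, setLIntegral_univ,
      ← ofReal_integral_eq_lintegral_ofReal hfi (.of_forall hpos)]
    simp
  obtain ⟨T₀, hT₀, hT₀μ⟩ := exists_measurable_map_eq_of_nullSingletonClass μ ν hmass
  obtain ⟨_, ⟨γ, hγ₁, hγ₂, rfl⟩, hγ⟩ := exists_lt_of_csInf_lt (s := { c : ℝ |
      ∃ γ : Measure (UnitAddCircle × UnitAddCircle), γ.map Prod.fst = μ ∧ γ.map Prod.snd = ν ∧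
        c = (∫ z, dist z.1 z.2 ^ (1 : ℝ) ∂γ) ^ (1 / (1 : ℝ)) })
    ⟨_, μ.map fun x => (x, T₀ x), by
      rw [Measure.map_map measurable_fst (measurable_id'.prodMk hT₀)]; exact Measure.map_id, by
      rw [Measure.map_map measurable_snd (measurable_id'.prodMk hT₀)]; exact hT₀μ, rfl⟩
    (lt_add_of_pos_right (Wdist 1 μ ν) (half_pos hε))
  simp only [Real.rpow_one, div_one] at hγ
  have : IsFiniteMeasure γ := ⟨by
    rw [← Set.preimage_univ (f := Prod.fst), ← Measure.map_apply measurable_fst .univ, hγ₁]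
    exact measure_lt_top μ _⟩
  have : NullSingletonClass (γ.map Prod.fst) := hγ₁ ▸ inferInstance
  obtain ⟨T, hT, hTγ, hTle⟩ := exists_measurable_map_integral_dist_le γ (half_pos hε)
  rw [hγ₁, hγ₂] at hTγ
  refine ⟨T, hT, hTγ, ?_⟩
  rw [hγ₁, hμ, integral_withDensity_eq_integral_toReal_smul hfm (by simp)] at hTle
  simp only [ENNReal.toReal_ofReal (hpos _), smul_eq_mul, mul_comm (f _)] at hTle
  linarith
end

section
/- For every 1 ≤ p < ∞ there is a constant C_p > 0 with the following property: for every continuous f : 𝕋 → ℝ with f ≥ 0 and every 0 < t ≤ 1, writing u_t(x) = ∫_𝕋 h_t(x − y) f(y) dy for the solution of the heat equation at time t with initial data f (where h_t(x) = Σ_{k ∈ ℤ} e^{−4π²k²t} e^{2πikx} is the heat kernel on 𝕋), one has u_t ≥ 0 and W_p(f dx, u_t dx) ≤ C_p ‖f‖_{L¹(𝕋)}^{1/p} √t. -/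
open MeasureTheory
open scoped ENNReal Real

/-- The heat kernel on the torus `𝕋 = ℝ/ℤ` at time `t`:
`h_t(x) = ∑_{k ∈ ℤ} e^{-4π²k²t} e^{2πikx}` (a real-valued function). -/
noncomputable def heatKernel (t : ℝ) (x : UnitAddCircle) : ℝ :=
  ∑' k : ℤ, Real.exp (-4 * π ^ 2 * (k : ℝ) ^ 2 * t) * (fourier k x).re

/-- The solution `u_t = h_t * f` of the heat equation on `𝕋` with initial data `f`. -/
noncomputable def heatSol (t : ℝ) (f : UnitAddCircle → ℝ) (x : UnitAddCircle) : ℝ :=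
  ∫ y, heatKernel t (x - y) * f y

section HeatFlow

open ProbabilityTheory

lemma UnitAddCircle.volume_eq_haarAddCircle :
    (volume : Measure UnitAddCircle) = AddCircle.haarAddCircle := by
  simp [AddCircle.volume_eq_smul_haarAddCircle]

lemma UnitAddCircle.norm_fourier_apply (k : ℤ) (x : UnitAddCircle) : ‖fourier k x‖ = 1 := by
  rw [fourier_apply]
  exact Circle.norm_coe _

/-- The projection of the scaled real line to the circle. -/
noncomputable def scaledProj (s z : ℝ) : UnitAddCircle := ((s * z : ℝ) : UnitAddCircle)

lemma continuous_scaledProj (s : ℝ) : Continuous (scaledProj s) :=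
  (AddCircle.continuous_mk' (1 : ℝ)).comp (continuous_const.mul continuous_id)

lemma norm_scaledProj_le (s z : ℝ) : ‖scaledProj s z‖ ≤ |s| * |z| := by
  have h : ‖scaledProj s z‖ ≤ ‖s * z‖ := QuotientAddGroup.norm_mk_le_norm
  simpa [abs_mul] using h

/-- The average of `f (x - s z)` for a standard Gaussian `z`. -/
noncomputable def gaussAvg {E : Type*} [NormedAddCommGroup E] [NormedSpace ℝ E]
    (s : ℝ) (f : UnitAddCircle → E) (x : UnitAddCircle) : E :=
  ∫ z, f (x - scaledProj s z) ∂(gaussianReal 0 1)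

lemma exists_norm_le_of_continuous {E : Type*} [NormedAddCommGroup E] {f : UnitAddCircle → E}
    (hf : Continuous f) : ∃ M, ∀ x, ‖f x‖ ≤ M := by
  obtain ⟨M, hM⟩ := isCompact_univ.exists_bound_of_continuousOn hf.continuousOn
  exact ⟨M, fun x => hM x (Set.mem_univ x)⟩

lemma continuous_gaussAvg {E : Type*} [NormedAddCommGroup E] [NormedSpace ℝ E]
    [SecondCountableTopology E] (s : ℝ) {f : UnitAddCircle → E} (hf : Continuous f) :
    Continuous (gaussAvg s f) := by
  obtain ⟨M, hM⟩ := exists_norm_le_of_continuous hf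
  refine continuous_of_dominated (bound := fun _ => M) (fun x => ?_) (fun x => ?_)
    (integrable_const M) ?_
  · exact (hf.comp (continuous_const.sub (continuous_scaledProj s))).aestronglyMeasurable
  · exact Filter.Eventually.of_forall fun z => hM _
  · exact Filter.Eventually.of_forall fun z => hf.comp (continuous_id.sub continuous_const)

lemma integral_fourier_scaledProj (s : ℝ) (k : ℤ) :
    ∫ z, fourier (-k) (scaledProj s z) ∂(gaussianReal 0 1)
      = (Real.exp (-(2 * π * k * s) ^ 2 / 2) : ℂ) := by
  have h := charFun_gaussianReal (μ := 0) (v := 1) (-(2 * π * k * s))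
  rw [charFun_apply_real] at h
  have h2 : ∀ z : ℝ, fourier (-k) (scaledProj s z)
      = Complex.exp (((-(2 * π * k * s) : ℝ) : ℂ) * z * Complex.I) := by
    intro z
    rw [scaledProj, fourier_coe_apply]
    congr 1
    push_cast
    ring
  simp_rw [h2]
  rw [h]
  push_cast
  congr 1
  ring

lemma fourierCoeff_gaussAvg (s : ℝ) {F : UnitAddCircle → ℂ} (hF : Continuous F) (k : ℤ) :
    fourierCoeff (gaussAvg s F) k
      = (Real.exp (-(2 * π * k * s) ^ 2 / 2) : ℂ) * fourierCoeff F k := by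
  obtain ⟨M, hM⟩ := exists_norm_le_of_continuous hF
  simp only [fourierCoeff, ← UnitAddCircle.volume_eq_haarAddCircle, gaussAvg, smul_eq_mul,
    ← integral_const_mul]
  rw [integral_integral_swap]
  · have h : ∀ z : ℝ, ∫ x : UnitAddCircle, fourier (-k) x * F (x - scaledProj s z)
        = fourier (-k) (scaledProj s z) * ∫ x : UnitAddCircle, fourier (-k) x * F x := by
      intro z
      rw [← integral_const_mul,
        ← integral_sub_right_eq_self (fun x : UnitAddCircle =>
          fourier (-k) (scaledProj s z) * (fourier (-k) x * F x)) (scaledProj s z)]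
      congr 1
      ext x
      have : fourier (-k) x
          = fourier (-k) (scaledProj s z) * fourier (-k) (x - scaledProj s z) := by
        rw [fourier_apply, fourier_apply, fourier_apply, ← Circle.coe_mul,
          ← AddCircle.toCircle_add, ← smul_add, add_sub_cancel]
      rw [this]
      ring
    simp_rw [h]
    rw [integral_mul_const, integral_fourier_scaledProj, integral_const_mul]
  · refine Integrable.of_bound (C := M) ?_ (Filter.Eventually.of_forall fun z => ?_)
    · refine Continuous.aestronglyMeasurable ?_
      exact ((fourier (-k)).continuous.comp continuous_fst).mul
        (hF.comp (continuous_fst.sub ((continuous_scaledProj s).comp continuous_snd)))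
    · rw [Function.uncurry_def, norm_mul, UnitAddCircle.norm_fourier_apply, one_mul]
      exact hM _

lemma summable_exp_neg_mul_int_sq {a : ℝ} (ha : 0 < a) :
    Summable fun k : ℤ => Real.exp (-a * (k : ℝ) ^ 2) := by
  refine (summable_int_iff_summable_nat_and_neg).2 ?_
  have h : Summable fun k : ℕ => Real.exp (-a * (k : ℝ) ^ 2) := by
    refine Summable.of_nonneg_of_le (fun k => (Real.exp_pos _).le) (fun k => ?_)
      (Real.summable_exp_nat_mul_iff.2 (neg_lt_zero.2 ha))
    refine Real.exp_le_exp.2 ?_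
    have : (k : ℝ) ≤ (k : ℝ) ^ 2 := by
      exact_mod_cast Nat.le_self_pow two_ne_zero k
    nlinarith
  exact ⟨by simpa using h, by simpa using h⟩

lemma hasSum_gaussAvg {s : ℝ} (hs : 0 < s) {F : UnitAddCircle → ℂ} (hF : Continuous F)
    (x : UnitAddCircle) :
    HasSum (fun k : ℤ => (Real.exp (-(2 * π * k * s) ^ 2 / 2) : ℂ) * fourierCoeff F k
      * fourier k x) (gaussAvg s F x) := by
  obtain ⟨M, hM⟩ := exists_norm_le_of_continuous hF
  have hcoef : ∀ k, ‖fourierCoeff F k‖ ≤ M := by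
    intro k
    rw [fourierCoeff]
    refine (norm_integral_le_of_norm_le_const (C := M)
      (Filter.Eventually.of_forall fun z => ?_)).trans (by simp)
    rw [norm_smul, UnitAddCircle.norm_fourier_apply, one_mul]
    exact hM z
  have hsum : Summable (fourierCoeff (gaussAvg s F)) := by
    refine Summable.of_norm_bounded
      (g := fun k : ℤ => Real.exp (-(2 * π ^ 2 * s ^ 2) * (k : ℝ) ^ 2) * M)
      ((summable_exp_neg_mul_int_sq (by positivity)).mul_right M) fun k => ?_
    rw [fourierCoeff_gaussAvg s hF, norm_mul, Complex.norm_real, Real.norm_eq_abs, Real.abs_exp,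
      show -(2 * π * k * s) ^ 2 / 2 = -(2 * π ^ 2 * s ^ 2) * (k : ℝ) ^ 2 by ring]
    exact mul_le_mul_of_nonneg_left (hcoef k) (Real.exp_pos _).le
  have h := has_pointwise_sum_fourier_series_of_summable
    (f := ⟨gaussAvg s F, continuous_gaussAvg s hF⟩) hsum x
  simpa [fourierCoeff_gaussAvg s hF] using h

lemma heatSol_eq_gaussAvg {f : UnitAddCircle → ℝ} (hf : Continuous f) {t : ℝ} (ht : 0 < t)
    (x : UnitAddCircle) : heatSol t f x = gaussAvg (√(2 * t)) f x := by
  have hF : Continuous fun y => (f y : ℂ) := Complex.continuous_ofReal.comp hf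
  obtain ⟨M, hM⟩ := exists_norm_le_of_continuous hf
  have hs : √(2 * t) ^ 2 = 2 * t := Real.sq_sqrt (by positivity)
  have h1 := Complex.hasSum_re (hasSum_gaussAvg (s := √(2 * t)) (by positivity) hF x)
  have hre : (gaussAvg (√(2 * t)) (fun y => (f y : ℂ)) x).re = gaussAvg (√(2 * t)) f x := by
    simp only [gaussAvg]
    rw [integral_complex_ofReal, Complex.ofReal_re]
  rw [hre] at h1
  have hcont : ∀ k : ℤ, Continuous fun y : UnitAddCircle => (fourier k (x - y)).re := fun k =>
    Complex.continuous_re.comp ((fourier k).continuous.comp (continuous_const.sub continuous_id))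
  have hbound : ∀ (k : ℤ) (y : UnitAddCircle), ‖Real.exp (-4 * π ^ 2 * (k : ℝ) ^ 2 * t)
      * (fourier k (x - y)).re * f y‖ ≤ Real.exp (-(4 * π ^ 2 * t) * (k : ℝ) ^ 2) * M := by
    intro k y
    rw [norm_mul, norm_mul, Real.norm_eq_abs, Real.abs_exp,
      show -4 * π ^ 2 * (k : ℝ) ^ 2 * t = -(4 * π ^ 2 * t) * (k : ℝ) ^ 2 by ring, mul_assoc]
    refine mul_le_mul_of_nonneg_left ?_ (Real.exp_pos _).le
    have h3 : ‖(fourier k (x - y)).re‖ ≤ 1 := by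
      refine (Complex.abs_re_le_norm _).trans ?_
      rw [UnitAddCircle.norm_fourier_apply]
    calc _ ≤ 1 * ‖f y‖ := mul_le_mul_of_nonneg_right h3 (norm_nonneg _)
      _ ≤ M := by simpa using hM y
  have hint : ∀ k : ℤ, Integrable (fun y : UnitAddCircle =>
      Real.exp (-4 * π ^ 2 * (k : ℝ) ^ 2 * t) * (fourier k (x - y)).re * f y) volume := fun k =>
    Integrable.of_bound ((continuous_const.mul (hcont k)).mul hf).aestronglyMeasurable _
      (Filter.Eventually.of_forall (hbound k))
  have h2 := hasSum_integral_of_summable_integral_norm hint (by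
    refine Summable.of_nonneg_of_le (fun k => integral_nonneg fun y => norm_nonneg _) (fun k => ?_)
      ((summable_exp_neg_mul_int_sq (a := 4 * π ^ 2 * t) (by positivity)).mul_right M)
    calc _ ≤ ∫ y : UnitAddCircle, Real.exp (-(4 * π ^ 2 * t) * (k : ℝ) ^ 2) * M :=
          integral_mono (hint k).norm (integrable_const _) (hbound k)
      _ = _ := by simp [measureReal_def])
  have hsol : heatSol t f x = ∫ y : UnitAddCircle, ∑' k : ℤ,
      Real.exp (-4 * π ^ 2 * (k : ℝ) ^ 2 * t) * (fourier k (x - y)).re * f y := by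
    simp only [heatSol, heatKernel, tsum_mul_right]
  rw [← hsol] at h2
  refine h2.unique ?_
  refine (congrArg (fun a => HasSum a _) (funext fun k => ?_)).mpr h1
  have hexp : -(2 * π * k * √(2 * t)) ^ 2 / 2 = -4 * π ^ 2 * (k : ℝ) ^ 2 * t := by
    rw [mul_pow, hs]
    ring
  have hmul : fourierCoeff (fun y => (f y : ℂ)) k * fourier k x
      = ∫ y : UnitAddCircle, fourier k (x - y) * (f y : ℂ) := by
    rw [fourierCoeff, ← UnitAddCircle.volume_eq_haarAddCircle, ← integral_mul_const]
    congr 1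
    ext y
    have : fourier k (x - y) = fourier k x * fourier (-k) y := by
      rw [fourier_apply, fourier_apply, fourier_apply, ← Circle.coe_mul,
        ← AddCircle.toCircle_add, neg_smul, ← sub_eq_add_neg, smul_sub]
    rw [this, smul_eq_mul]
    ring
  have hci : Integrable (fun y : UnitAddCircle => fourier k (x - y) * (f y : ℂ)) volume :=
    Integrable.of_bound (C := M) (((fourier k).continuous.comp
      (continuous_const.sub continuous_id)).mul hF).aestronglyMeasurable
      (Filter.Eventually.of_forall fun y => by
        rw [norm_mul, UnitAddCircle.norm_fourier_apply, one_mul, Complex.norm_real]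
        exact hM y)
  rw [hexp, mul_assoc (Complex.ofReal _), Complex.re_ofReal_mul, hmul]
  have hre' : (∫ y : UnitAddCircle, fourier k (x - y) * (f y : ℂ)).re
      = ∫ y : UnitAddCircle, (fourier k (x - y) * (f y : ℂ)).re := (integral_re hci).symm
  rw [hre', ← integral_const_mul]
  simp only [Complex.re_mul_ofReal, mul_assoc]

lemma map_snd_coupling {f : UnitAddCircle → ℝ} (hf : Continuous f) (h0 : ∀ x, 0 ≤ f x) (s : ℝ) :
    (((volume.withDensity fun x => ENNReal.ofReal (f x)).prod (gaussianReal 0 1)).map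
      fun z : UnitAddCircle × ℝ => z.1 + scaledProj s z.2)
      = volume.withDensity fun x => ENNReal.ofReal (gaussAvg s f x) := by
  obtain ⟨M, hM⟩ := exists_norm_le_of_continuous hf
  have hp := (continuous_scaledProj s).measurable
  have hfm : Measurable fun x => ENNReal.ofReal (f x) := hf.measurable.ennreal_ofReal
  refine Measure.ext_of_lintegral _ fun φ hφ => ?_
  have hgm : Measurable fun x => ENNReal.ofReal (gaussAvg s f x) :=
    (continuous_gaussAvg s hf).measurable.ennreal_ofReal
  rw [lintegral_map hφ (by fun_prop), lintegral_prod _ (by fun_prop),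
    lintegral_withDensity_eq_lintegral_mul _ hfm (Measurable.lintegral_prod_right (by fun_prop)),
    lintegral_withDensity_eq_lintegral_mul _ hgm hφ]
  simp only [Pi.mul_apply]
  calc ∫⁻ x, ENNReal.ofReal (f x) * ∫⁻ z, φ (x + scaledProj s z) ∂gaussianReal 0 1
      = ∫⁻ x, ∫⁻ z, ENNReal.ofReal (f x) * φ (x + scaledProj s z) ∂gaussianReal 0 1 := by
        refine lintegral_congr fun x => (lintegral_const_mul _ (by fun_prop)).symm
    _ = ∫⁻ z, (∫⁻ x, ENNReal.ofReal (f x) * φ (x + scaledProj s z)) ∂gaussianReal 0 1 :=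
        lintegral_lintegral_swap (by fun_prop)
    _ = ∫⁻ z, (∫⁻ x, ENNReal.ofReal (f (x - scaledProj s z)) * φ x) ∂gaussianReal 0 1 := by
        refine lintegral_congr fun z => ?_
        rw [← lintegral_add_right_eq_self (fun x : UnitAddCircle =>
          ENNReal.ofReal (f (x - scaledProj s z)) * φ x) (scaledProj s z)]
        simp
    _ = ∫⁻ x, ∫⁻ z, ENNReal.ofReal (f (x - scaledProj s z)) * φ x ∂gaussianReal 0 1 :=
        lintegral_lintegral_swap (by fun_prop)
    _ = _ := by
        refine lintegral_congr fun x => ?_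
        rw [lintegral_mul_const _ (by fun_prop), gaussAvg, ofReal_integral_eq_lintegral_ofReal _
          (Filter.Eventually.of_forall fun z => h0 _)]
        exact Integrable.of_bound
          (hf.comp (continuous_const.sub (continuous_scaledProj s))).aestronglyMeasurable M
          (Filter.Eventually.of_forall fun z => hM _)

end HeatFlow

/-- Transport bound for heat flow: for `1 ≤ p < ∞` there is `C_p > 0` such that
for continuous `f ≥ 0` on `𝕋` and `0 < t ≤ 1`, the heat-flow solution `u_t`
is nonnegative and `W_p(f dx, u_t dx) ≤ C_p ‖f‖₁^{1/p} √t`. -/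
theorem stmt15 (p : ℝ) (hp : 1 ≤ p) : ∃ C : ℝ, 0 < C ∧
    ∀ f : UnitAddCircle → ℝ, Continuous f → (∀ x, 0 ≤ f x) →
    ∀ t : ℝ, 0 < t → t ≤ 1 →
      (∀ x, 0 ≤ heatSol t f x) ∧
      Wdist p (volume.withDensity fun x => ENNReal.ofReal (f x))
          (volume.withDensity fun x => ENNReal.ofReal (heatSol t f x)) ≤
        C * (∫ x, |f x|) ^ (1 / p) * Real.sqrt t := by
  set K : ℝ := ∫ z, |z| ^ p ∂(ProbabilityTheory.gaussianReal 0 1) with hK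
  have hp0 : 0 < p := by linarith
  have hK0 : 0 ≤ K := integral_nonneg fun z => by positivity
  have hKint : Integrable (fun z : ℝ => |z| ^ p) (ProbabilityTheory.gaussianReal 0 1) := by
    have h := (ProbabilityTheory.memLp_id_gaussianReal' (μ := 0) (v := 1) (ENNReal.ofReal p)
      ENNReal.ofReal_ne_top).integrable_norm_rpow (by simpa using hp0) ENNReal.ofReal_ne_top
    simpa [ENNReal.toReal_ofReal hp0.le] using h
  refine ⟨√2 * (K + 1) ^ (1 / p), by positivity, fun f hf h0 t ht _ => ?_⟩
  have hu : heatSol t f = gaussAvg (√(2 * t)) f := funext (heatSol_eq_gaussAvg hf ht)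
  rw [hu]
  refine ⟨fun x => integral_nonneg fun z => h0 _, ?_⟩
  obtain ⟨M, hM⟩ := exists_norm_le_of_continuous hf
  have hfi : Integrable f volume :=
    Integrable.of_bound hf.aestronglyMeasurable M (Filter.Eventually.of_forall hM)
  set s := √(2 * t) with hs
  have hs0 : 0 ≤ s := Real.sqrt_nonneg _
  have hpm := (continuous_scaledProj s).measurable
  set μ : Measure UnitAddCircle := volume.withDensity fun x => ENNReal.ofReal (f x) with hμ
  have : IsFiniteMeasure μ := isFiniteMeasure_withDensity_ofReal hfi.2
  have hμm : μ.real Set.univ = ∫ x, f x := by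
    rw [hμ, measureReal_def, withDensity_apply _ MeasurableSet.univ, Measure.restrict_univ,
      integral_eq_lintegral_of_nonneg_ae (Filter.Eventually.of_forall h0)
        hf.aestronglyMeasurable]
  have hm : Measurable fun z : UnitAddCircle × ℝ => (z.1, z.1 + scaledProj s z.2) := by fun_prop
  have habs : ∫ x, |f x| = ∫ x, f x := by simp only [abs_of_nonneg (h0 _)]
  have hf0 : 0 ≤ ∫ x, f x := integral_nonneg h0
  have hcost : ∫ z, dist z.1 z.2 ^ p
      ∂((μ.prod (ProbabilityTheory.gaussianReal 0 1)).map fun z : UnitAddCircle × ℝ =>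
        (z.1, z.1 + scaledProj s z.2)) ≤ (∫ x, f x) * (s ^ p * K) := by
    rw [integral_map hm.aemeasurable]
    · calc _ ≤ ∫ z : UnitAddCircle × ℝ, s ^ p * |z.2| ^ p ∂(μ.prod (ProbabilityTheory.gaussianReal 0 1)) := by
            refine integral_mono_of_nonneg
              (Filter.Eventually.of_forall fun z => Real.rpow_nonneg dist_nonneg _)
              ((hKint.const_mul (s ^ p)).comp_snd μ)
              (Filter.Eventually.of_forall fun z => ?_)
            simp only [dist_self_add_right]
            rw [← Real.mul_rpow hs0 (abs_nonneg _)]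
            refine Real.rpow_le_rpow (norm_nonneg _) ?_ hp0.le
            simpa [abs_of_nonneg hs0] using norm_scaledProj_le s z.2
        _ = _ := by
            rw [integral_fun_snd (fun z : ℝ => s ^ p * |z| ^ p), hμm, integral_const_mul,
              smul_eq_mul]
    · exact (Continuous.rpow_const continuous_dist fun _ => Or.inr hp0.le).aestronglyMeasurable
  have hcost0 : 0 ≤ ∫ z, dist z.1 z.2 ^ p
      ∂((μ.prod (ProbabilityTheory.gaussianReal 0 1)).map fun z : UnitAddCircle × ℝ =>
        (z.1, z.1 + scaledProj s z.2)) :=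
    integral_nonneg fun z => Real.rpow_nonneg dist_nonneg _
  refine le_trans (csInf_le ⟨0, ?_⟩ ⟨(μ.prod (ProbabilityTheory.gaussianReal 0 1)).map
      fun z : UnitAddCircle × ℝ => (z.1, z.1 + scaledProj s z.2), ?_, ?_, rfl⟩)
    ((Real.rpow_le_rpow hcost0 hcost (one_div_nonneg.2 hp0.le)).trans ?_)
  · rintro c ⟨γ, -, -, rfl⟩
    exact Real.rpow_nonneg (integral_nonneg fun z => Real.rpow_nonneg dist_nonneg _) _
  · rw [Measure.map_map measurable_fst hm]
    exact (measurePreserving_fst (μ := μ) (ν := ProbabilityTheory.gaussianReal 0 1)).map_eq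
  · rw [Measure.map_map measurable_snd hm]
    exact map_snd_coupling hf h0 s
  · rw [habs, Real.mul_rpow hf0 (by positivity), Real.mul_rpow (by positivity) hK0,
      ← Real.rpow_mul hs0, mul_one_div_cancel hp0.ne', Real.rpow_one, hs,
      Real.sqrt_mul (by norm_num)]
    have : K ^ (1 / p) ≤ (K + 1) ^ (1 / p) :=
      Real.rpow_le_rpow hK0 (by linarith) (by positivity)
    calc _ = ((∫ x, f x) ^ (1 / p) * (√2 * √t)) * K ^ (1 / p) := by ring
      _ ≤ ((∫ x, f x) ^ (1 / p) * (√2 * √t)) * (K + 1) ^ (1 / p) := by gcongr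
      _ = _ := by ring
end

section
/- Let α ∈ ℝ be badly approximable. Then there is a constant C = C(α) > 0 such that for every integer N ≥ 2, the empirical measure μ_N = (1/N) Σ_{n=1}^{N} δ_{{nα}} satisfies D(μ_N) ≤ C (log N)² / N. -/
open MeasureTheory
open scoped ENNReal

open Classical in
/-- The number of `n < N` for which `x + nα` lies in `[a, b)` modulo `1`. -/
noncomputable def arcCount (a b α x : ℝ) (N : ℕ) : ℝ :=
  ∑ n ∈ Finset.range N, if ∃ k : ℤ, x + n * α + k ∈ Set.Ico a b then 1 else 0

lemma arcCount_add (a b α x : ℝ) (M N : ℕ) :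
    arcCount a b α x (M + N) = arcCount a b α x M + arcCount a b α (x + M * α) N := by
  unfold arcCount
  rw [Finset.sum_range_add]
  congr 1
  refine Finset.sum_congr rfl fun n _ => ?_
  have h : x + ((M + n : ℕ) : ℝ) * α = x + M * α + n * α := by push_cast; ring
  rw [h]

lemma le_arcCount_add_arcCount (a b α x : ℝ) (N : ℕ) :
    (N : ℝ) ≤ arcCount a b α x N + arcCount b (a + 1) α x N := by
  unfold arcCount
  rw [← Finset.sum_add_distrib]
  calc (N : ℝ) = ∑ _n ∈ Finset.range N, (1 : ℝ) := by simp
    _ ≤ _ := Finset.sum_le_sum fun n _ => ?_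
  obtain ⟨k, hk, -⟩ := existsUnique_add_zsmul_mem_Ico (zero_lt_one' ℝ) (x + n * α) a
  rw [zsmul_one] at hk
  by_cases hb : x + n * α + k < b
  · rw [if_pos ⟨k, hk.1, hb⟩]
    split_ifs <;> norm_num
  · rw [if_pos (c := ∃ k : ℤ, x + n * α + k ∈ Set.Ico b (a + 1)) ⟨k, not_lt.1 hb, hk.2⟩]
    split_ifs <;> norm_num

/-- A block whose length is the denominator of a good rational approximation to `α` visits
every arc at most a bounded number of times more than expected. -/
lemma arcCount_den_le {a b α : ℝ} (hab : a ≤ b) (x : ℝ) (r : ℚ)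
    (hr : |α - r| ≤ 1 / (r.den : ℝ) ^ 2) :
    arcCount a b α x r.den ≤ r.den * (b - a) + 4 := by
  classical
  have hq : (0 : ℝ) < r.den := by exact_mod_cast r.den_pos
  have hrq : (r : ℝ) * r.den = r.num := by exact_mod_cast Rat.mul_den_eq_num r
  unfold arcCount
  rw [← Finset.sum_filter, Finset.sum_const, nsmul_one]
  set S := (Finset.range r.den).filter
    fun n : ℕ => ∃ k : ℤ, x + n * α + k ∈ Set.Ico a b with hS
  have hex : ∀ n : ℕ, ∃ k : ℤ, n ∈ S → x + n * α + k ∈ Set.Ico a b := fun n => by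
    by_cases h : n ∈ S
    · obtain ⟨k, hk⟩ := (Finset.mem_filter.1 h).2
      exact ⟨k, fun _ => hk⟩
    · exact ⟨0, fun h' => absurd h' h⟩
  choose k hk using hex
  have hcard : S.card ≤ (Finset.Icc ⌈r.den * a - 2⌉ ⌊r.den * b + 1⌋).card := by
    refine Finset.card_le_card_of_injOn
      (fun n => ⌊r.den * x⌋ + n * r.num + r.den * k n) (fun n hn => ?_) fun m hm n hn h => ?_
    · obtain ⟨h1, h2⟩ := hk n hn
      have hn' : (n : ℝ) ≤ r.den := by
        exact_mod_cast (Finset.mem_range.1 (Finset.mem_filter.1 hn).1).le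
      have herr : |r.den * n * (α - r)| ≤ 1 := by
        rw [abs_mul, abs_of_nonneg (by positivity)]
        calc (r.den : ℝ) * n * |α - r| ≤ r.den * r.den * (1 / (r.den : ℝ) ^ 2) := by gcongr
          _ = 1 := by field_simp
      obtain ⟨h3, h4⟩ := abs_le.1 herr
      have h5 := Int.floor_le ((r.den : ℝ) * x)
      have h6 := Int.lt_floor_add_one ((r.den : ℝ) * x)
      have h7 := mul_le_mul_of_nonneg_left h1 hq.le
      have h8 := mul_le_mul_of_nonneg_left h2.le hq.le
      have h9 : (r.den : ℝ) * n * (α - r) = r.den * n * α - n * r.num := by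
        rw [← hrq]; ring
      simp only [Finset.coe_Icc, Set.mem_Icc, Int.ceil_le, Int.le_floor]
      push_cast
      constructor <;> linarith
    · have hdvd : (r.den : ℤ) ∣ ((m : ℤ) - n) * r.num :=
        ⟨k n - k m, by simp only at h; linear_combination h⟩
      have hcop : IsCoprime (r.den : ℤ) r.num := by
        rw [Int.isCoprime_iff_nat_coprime]
        simpa using r.reduced.symm
      have hmod := hcop.dvd_of_dvd_mul_right hdvd
      have hm' := Finset.mem_range.1 (Finset.mem_filter.1 hm).1
      have hn' := Finset.mem_range.1 (Finset.mem_filter.1 hn).1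
      have := Int.eq_zero_of_abs_lt_dvd hmod (by rw [abs_lt]; constructor <;> omega)
      omega
  have hcard' : (S.card : ℝ) ≤ ((Finset.Icc ⌈r.den * a - 2⌉ ⌊r.den * b + 1⌋).card : ℝ) := by
    exact_mod_cast hcard
  refine hcard'.trans ?_
  rw [Int.card_Icc]
  have hmax : (((⌊r.den * b + 1⌋ + 1 - ⌈r.den * a - 2⌉).toNat : ℤ) : ℝ)
      = max ((⌊r.den * b + 1⌋ + 1 - ⌈r.den * a - 2⌉ : ℤ) : ℝ) 0 := by
    rw [Int.toNat_eq_max]; push_cast; rfl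
  rw [← Int.cast_natCast, hmax]
  refine max_le ?_ (by nlinarith)
  have h1 := Int.floor_le ((r.den : ℝ) * b + 1)
  have h2 := Int.le_ceil ((r.den : ℝ) * a - 2)
  push_cast
  linarith

lemma BadlyApproximable.exists_den_ge {α : ℝ} (hα : BadlyApproximable α) :
    ∃ c : ℝ, 0 < c ∧ ∀ N : ℕ, 0 < N → ∃ r : ℚ,
      r.den ≤ N ∧ c * N ≤ r.den ∧ |α - r| ≤ 1 / (r.den : ℝ) ^ 2 := by
  obtain ⟨c, hc, h⟩ := hα
  refine ⟨c, hc, fun N hN => ?_⟩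
  obtain ⟨r, hr, hrN⟩ := Real.exists_rat_abs_sub_le_and_den_le α hN
  have hq : (0 : ℝ) < r.den := by exact_mod_cast r.den_pos
  have hqN : (r.den : ℝ) ≤ N := by exact_mod_cast hrN
  refine ⟨r, hrN, ?_, hr.trans ?_⟩
  · have h1 := h r.num r.den r.den_pos
    rw [← Rat.cast_def] at h1
    have h2 := h1.trans hr
    rw [div_le_div_iff₀ (by positivity) (by positivity)] at h2
    have h3 : c * (N + 1) ≤ r.den := le_of_mul_le_mul_right (by linarith) hq
    linarith
  · rw [sq]
    gcongr
    linarith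

lemma BadlyApproximable.exists_arcCount_le {α : ℝ} (hα : BadlyApproximable α) :
    ∃ A : ℝ, 0 < A ∧ ∀ a b : ℝ, a ≤ b → ∀ N : ℕ, 0 < N → ∀ x : ℝ,
      arcCount a b α x N ≤ N * (b - a) + A * (1 + Real.log N) := by
  obtain ⟨c, hc, h⟩ := hα.exists_den_ge
  refine ⟨4 / c + 4, by positivity, fun a b hab N => ?_⟩
  induction N using Nat.strong_induction_on with
  | _ N ih =>
    intro hN x
    obtain ⟨r, hrN, hcr, hr⟩ := h N hN
    have hblock := arcCount_den_le hab x r hr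
    have hN' : (0 : ℝ) < N := by exact_mod_cast hN
    have hlog : 0 ≤ Real.log N := Real.log_natCast_nonneg N
    rcases hrN.eq_or_lt with heq | hlt
    · rw [heq] at hblock
      have : 0 < 4 / c := by positivity
      nlinarith
    · obtain ⟨M, rfl⟩ := Nat.exists_eq_add_of_lt hlt
      rw [add_assoc] at *
      set L := M + 1 with hL
      have hrec := ih L (by have := r.den_pos; omega) (by omega) (x + r.den * α)
      have hL' : (0 : ℝ) < L := by positivity
      have hlogL : Real.log L ≤ Real.log (r.den + L : ℕ) - c := by
        have h1 := Real.log_le_sub_one_of_pos (div_pos hL' hN')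
        rw [Real.log_div hL'.ne' hN'.ne'] at h1
        have h2 : (L : ℝ) / (r.den + L : ℕ) ≤ 1 - c := by
          rw [div_le_iff₀ hN']
          push_cast at hcr ⊢
          linarith
        linarith
      rw [arcCount_add]
      have h3 : (4 / c + 4) * Real.log L ≤ (4 / c + 4) * (Real.log (r.den + L : ℕ) - c) := by
        gcongr
      have h4 : 4 / c * c = 4 := by field_simp
      push_cast at *
      linarith

lemma UnitAddCircle.coe_mem_image_Ico {a b y : ℝ} :
    (y : UnitAddCircle) ∈ (fun x : ℝ => (x : UnitAddCircle)) '' Set.Ico a b ↔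
      ∃ k : ℤ, y + k ∈ Set.Ico a b := by
  constructor
  · rintro ⟨z, hz, hzy⟩
    obtain ⟨k, hk⟩ := (AddCircle.coe_eq_zero_iff (p := (1 : ℝ)) (x := z - y)).1 (by
      rw [AddCircle.coe_sub]; exact sub_eq_zero.2 hzy)
    refine ⟨k, ?_⟩
    rw [zsmul_one] at hk
    rwa [hk, add_sub_cancel]
  · rintro ⟨k, hk⟩
    refine ⟨_, hk, ?_⟩
    simp

lemma kroneckerMeasure_image_Ico (α a b : ℝ) (N : ℕ) :
    (kroneckerMeasure α N ((fun x : ℝ => (x : UnitAddCircle)) '' Set.Ico a b)).toReal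
      = arcCount a b α α N / N := by
  classical
  unfold kroneckerMeasure arcCount
  rw [Measure.smul_apply, Measure.finsetSum_apply, smul_eq_mul, ENNReal.toReal_mul,
    ENNReal.toReal_inv, ENNReal.toReal_natCast, ENNReal.toReal_sum (fun _ _ => measure_ne_top _ _),
    div_eq_inv_mul, ← Finset.Ico_add_one_right_eq_Icc, Finset.sum_Ico_eq_sum_range]
  congr 1
  refine Finset.sum_congr rfl fun n _ => ?_
  rw [Measure.dirac_apply, Set.indicator_apply, UnitAddCircle.coe_mem_image_Ico]
  have h : ((1 + n : ℕ) : ℝ) * α = α + n * α := by push_cast; ring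
  rw [h]
  split_ifs <;> simp

/-- For badly approximable `α`, the Kronecker sequence satisfies the discrepancy
bound `D(μ_N) ≤ C (log N)²/N`. -/
theorem stmt18 (α : ℝ) (hα : BadlyApproximable α) : ∃ C : ℝ, 0 < C ∧
    ∀ N : ℕ, 2 ≤ N →
      discrepancy (kroneckerMeasure α N) ≤ C * Real.log N ^ 2 / N := by
  obtain ⟨A, hA, h⟩ := hα.exists_arcCount_le
  refine ⟨6 * A, by positivity, fun N hN => ?_⟩
  have hN' : (0 : ℝ) < N := by positivity
  refine Real.sSup_le ?_ (by positivity)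
  rintro d ⟨a, b, hab, hba, rfl⟩
  rw [kroneckerMeasure_image_Ico]
  have h1 := h a b hab N (by omega) α
  have h2 := h b (a + 1) hba N (by omega) α
  have h3 := le_arcCount_add_arcCount a b α α N
  have hlog : 1 / 2 ≤ Real.log N := by
    have := Real.log_le_log (by norm_num) (show (2 : ℝ) ≤ N by exact_mod_cast hN)
    linarith [Real.log_two_gt_d9]
  have h4 : A * (1 + Real.log N) ≤ 6 * A * Real.log N ^ 2 := by
    rw [mul_comm 6 A, mul_assoc]
    gcongr
    nlinarith
  rw [show arcCount a b α α N / N - (b - a) = (arcCount a b α α N - N * (b - a)) / N by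
    field_simp, abs_div, abs_of_pos hN']
  gcongr
  rw [abs_le]
  constructor <;> linarith
end
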